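/- arXiv:math/0412407 — 5 statements merged into one kernel-verified Lean document; each statement's English description precedes it below -/
import Mathlib

section
/- Fix real numbers q with 0 < q < 1 and x > 0. Define f_{q,x}(t) = 2^{2q} √2 x π^{-1/2} t^{-3/2} ∑_{k=0}^∞ C(-2q, k)(k+q) e^{-2x²(k+q)²/t} for t > 0. Then for every real s > 0, the integral ∫_0^∞ e^{-st} f_{q,x}(t) dt converges and equals (cosh(x√(2s)))^{-2q}. -/
open scoped Real
open MeasureTheory

/-- The generalized binomial coefficient `C(a, k) = a(a-1)⋯(a-k+1)/k!` for real `a`. -/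
noncomputable def genBinom (a : ℝ) (k : ℕ) : ℝ :=
  (∏ i ∈ Finset.range k, (a - i)) / (Nat.factorial k)

/-- The scaling-form first-passage density
`f_{q,x}(t) = 2^{2q} √2 x π^{-1/2} t^{-3/2} ∑_{k≥0} C(-2q,k)(k+q) e^{-2x²(k+q)²/t}`. -/
noncomputable def fpDensity (q x t : ℝ) : ℝ :=
  (2 : ℝ) ^ (2 * q) * Real.sqrt 2 * x * Real.pi ^ (-(1 / 2 : ℝ)) * t ^ (-(3 / 2 : ℝ)) *
    ∑' k : ℕ, genBinom (-(2 * q)) k * (k + q) * Real.exp (-(2 * x ^ 2 * (k + q) ^ 2 / t))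

open Filter Topology Set

lemma genBinom_eq_choose (a : ℝ) (k : ℕ) : genBinom a k = Ring.choose a k := by
  rw [Ring.choose_eq_smul, Polynomial.descPochhammer_smeval_eq_ascPochhammer,
    Polynomial.ascPochhammer_smeval_eq_eval, ← descPochhammer_eval_eq_ascPochhammer,
    descPochhammer_eval_eq_prod_range, genBinom, div_eq_inv_mul, smul_eq_mul]

lemma hasSum_genBinom (a z : ℝ) (h0 : |z| < 1) :
    HasSum (fun k : ℕ => genBinom a k * z ^ k) ((1 + z) ^ a) := by
  have h := (Real.one_add_rpow_hasFPowerSeriesOnBall_zero (a := a)).hasSum (y := z) (by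
    rw [← ENNReal.ofReal_one, Metric.eball_ofReal]; simpa using h0)
  simp only [zero_add] at h
  refine h.congr_fun ?_
  intro k
  simp [genBinom_eq_choose, -FormalMultilinearSeries.apply_eq_prod_smul_coeff,
    -FormalMultilinearSeries.apply_eq_pow_smul_coeff]

lemma ftc_aux (g g' : ℝ → ℝ) (l m : ℝ) (h0 : Tendsto g (𝓝[>] 0) (𝓝 l))
    (hd : ∀ x ∈ Ioi (0:ℝ), HasDerivAt g (g' x) x) (hp : ∀ x ∈ Ioi (0:ℝ), 0 ≤ g' x)
    (h1 : Tendsto g atTop (𝓝 m)) :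
    IntegrableOn g' (Ioi 0) ∧ ∫ x in Ioi (0:ℝ), g' x = m - l := by
  have hc : ContinuousWithinAt (Function.update g 0 l) (Ici 0) 0 := by
    rw [continuousWithinAt_update_same, Set.Ici_sdiff_left]
    exact h0
  have hd' : ∀ x ∈ Ioi (0:ℝ), HasDerivAt (Function.update g 0 l) (g' x) x := by
    intro x hx
    refine (hd x hx).congr_of_eventuallyEq ?_
    filter_upwards [Ioi_mem_nhds hx] with y hy
    exact Function.update_of_ne (ne_of_gt hy) _ _
  have h1' : Tendsto (Function.update g 0 l) atTop (𝓝 m) := by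
    refine h1.congr' ?_
    filter_upwards [eventually_gt_atTop 0] with y hy
    exact (Function.update_of_ne (ne_of_gt hy) _ _).symm
  refine ⟨integrableOn_Ioi_deriv_of_nonneg hc hd' hp h1', ?_⟩
  rw [integral_Ioi_of_hasDerivAt_of_nonneg hc hd' hp h1']
  simp

noncomputable def gE (z : ℝ) : ℝ := ∫ w in (0:ℝ)..z, Real.exp (-w ^ 2)

lemma gE_deriv (z : ℝ) : HasDerivAt gE (Real.exp (-z ^ 2)) z := by
  have hc : Continuous (fun w : ℝ => Real.exp (-w ^ 2)) := by fun_prop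
  exact hc.integral_hasStrictDerivAt 0 z |>.hasDerivAt

lemma gE_top : Tendsto gE atTop (𝓝 (√π / 2)) := by
  have h := integral_gaussian_Ioi 1
  have hi := (integrable_exp_neg_mul_sq (b := 1) one_pos).integrableOn (s := Ioi 0)
  have := intervalIntegral_tendsto_integral_Ioi 0 hi tendsto_id
  rw [h] at this
  have h2 : gE = fun z => ∫ w in (0:ℝ)..z, Real.exp (-w ^ 2) := rfl
  rw [h2]
  simpa using this

lemma gE_neg (z : ℝ) : gE (-z) = - gE z := by
  have := intervalIntegral.integral_comp_neg (a := 0) (b := z) (fun w : ℝ => Real.exp (-w ^ 2))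
  rw [gE, gE, intervalIntegral.integral_symm]
  simp at this
  rw [this]

lemma gE_bot : Tendsto gE atBot (𝓝 (-(√π / 2))) := by
  have := (gE_top.comp tendsto_neg_atBot_atTop).neg
  refine this.congr fun z => ?_
  simp [gE_neg]

lemma levy (c r : ℝ) (hc : 0 < c) (hr : 0 < r) :
    IntegrableOn (fun t : ℝ => c * t ^ (-(3 / 2 : ℝ)) * Real.exp (-(c ^ 2 / t) - r ^ 2 * t)) (Ioi 0)
    ∧ ∫ t in Ioi (0:ℝ), c * t ^ (-(3 / 2 : ℝ)) * Real.exp (-(c ^ 2 / t) - r ^ 2 * t)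
      = √π * Real.exp (-(2 * c * r)) := by
  have sq0 : Tendsto (fun t : ℝ => √t) (𝓝[>] 0) (𝓝[>] 0) := by
    refine tendsto_nhdsWithin_iff.2 ⟨?_, ?_⟩
    · have : Tendsto (fun t : ℝ => √t) (𝓝 0) (𝓝 √0) := Real.continuous_sqrt.tendsto 0
      rw [Real.sqrt_zero] at this
      exact this.mono_left nhdsWithin_le_nhds
    · filter_upwards [self_mem_nhdsWithin] with t ht
      exact Real.sqrt_pos.2 ht
  have sqT : Tendsto (fun t : ℝ => √t) atTop atTop := Real.tendsto_sqrt_atTop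
  have a0 : Tendsto (fun t : ℝ => c / √t) (𝓝[>] 0) atTop := by
    simpa [div_eq_mul_inv] using (tendsto_inv_nhdsGT_zero.comp sq0).const_mul_atTop hc
  have b0 (d : ℝ) : Tendsto (fun t : ℝ => d * √t) (𝓝[>] 0) (𝓝 0) := by
    simpa using (tendsto_nhdsWithin_iff.1 sq0).1.const_mul d
  have aT : Tendsto (fun t : ℝ => c / √t) atTop (𝓝 0) := sqT.const_div_atTop c
  have u0 (d : ℝ) : Tendsto (fun t : ℝ => c / √t + d * √t) (𝓝[>] 0) atTop :=
    a0.atTop_add (b0 d)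
  have vT : Tendsto (fun t : ℝ => c / √t + r * √t) atTop atTop :=
    aT.add_atTop (sqT.const_mul_atTop hr)
  have uT : Tendsto (fun t : ℝ => c / √t + (-r) * √t) atTop atBot :=
    aT.add_atBot (sqT.const_mul_atTop_of_neg (neg_lt_zero.2 hr))
  have hder (d t : ℝ) (ht : 0 < t) : HasDerivAt (fun t : ℝ => c / √t + d * √t)
      (-(c / (t * √t)) / 2 + d / √t / 2) t := by
    have hs : 0 < √t := Real.sqrt_pos.2 ht
    have h1 := Real.hasDerivAt_sqrt ht.ne'
    have := ((hasDerivAt_const t c).div h1 hs.ne').add (h1.const_mul d)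
    refine this.congr_deriv ?_
    have : √t ^ 2 = t := Real.sq_sqrt ht.le
    rw [show c / (t * √t) = c / (√t ^ 2 * √t) by rw [this]]
    field_simp
    ring
  have key := ftc_aux
    (fun t => -(Real.exp (-(2 * c * r)) * gE (c / √t + (-r) * √t)
        + Real.exp (2 * c * r) * gE (c / √t + r * √t)))
    (fun t : ℝ => c * t ^ (-(3 / 2 : ℝ)) * Real.exp (-(c ^ 2 / t) - r ^ 2 * t))
    _ _
    (((gE_top.comp (u0 (-r))).const_mul _).add ((gE_top.comp (u0 r)).const_mul _)).neg
    ?_ ?_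
    (((gE_bot.comp uT).const_mul _).add ((gE_top.comp vT).const_mul _)).neg
  · refine ⟨key.1, key.2.trans ?_⟩
    ring
  · intro t ht
    have ht : 0 < t := ht
    have hs : 0 < √t := Real.sqrt_pos.2 ht
    have h2 : √t ^ 2 = t := Real.sq_sqrt ht.le
    have := ((((gE_deriv _).comp t (hder (-r) t ht)).const_mul (Real.exp (-(2 * c * r)))).add
      (((gE_deriv _).comp t (hder r t ht)).const_mul (Real.exp (2 * c * r)))).neg
    refine this.congr_deriv ?_
    have e (d : ℝ) : -(c / √t + d * √t) ^ 2 = (-(c ^ 2 / t) - d ^ 2 * t) - 2 * c * d := by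
      have : (c / √t + d * √t) ^ 2 = c ^ 2 / √t ^ 2 + d ^ 2 * √t ^ 2 + 2 * c * d := by
        field_simp
        ring
      rw [this, h2]
      ring
    have e3 : t ^ (-(3 / 2 : ℝ)) = 1 / (t * √t) := by
      rw [Real.rpow_neg ht.le, show (3 / 2 : ℝ) = 1 + 1 / 2 by norm_num, Real.rpow_add ht,
        Real.rpow_one, ← Real.sqrt_eq_rpow, one_div]
    rw [e, e, e3, neg_sq]
    set A := -(c ^ 2 / t) - r ^ 2 * t
    have k1 : Real.exp (A - 2 * c * (-r)) = Real.exp A * Real.exp (2 * c * r) := by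
      rw [← Real.exp_add]; ring_nf
    have k2 : Real.exp (A - 2 * c * r) = Real.exp A * Real.exp (-(2 * c * r)) := by
      rw [← Real.exp_add]; ring_nf
    have k3 : Real.exp (2 * c * r) * Real.exp (-(2 * c * r)) = 1 := by
      rw [← Real.exp_add]; simp
    rw [k1, k2]
    linear_combination (c / (t * √t) * Real.exp A) * k3
  · intro t ht
    have ht : 0 < t := ht
    positivity

/-- For `0 < q < 1`, `x > 0` and every `s > 0`, the Laplace transform
`∫_0^∞ e^{-st} f_{q,x}(t) dt` converges and equals `(cosh(x√(2s)))^{-2q}`. -/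
theorem laplace_transform_fpDensity (q x : ℝ) (hq0 : 0 < q) (hq1 : q < 1) (hx : 0 < x) :
    ∀ s : ℝ, 0 < s →
      IntegrableOn (fun t : ℝ => Real.exp (-(s * t)) * fpDensity q x t) (Set.Ioi 0) ∧
      ∫ t in Set.Ioi (0 : ℝ), Real.exp (-(s * t)) * fpDensity q x t =
        Real.cosh (x * Real.sqrt (2 * s)) ^ (-(2 * q)) := by
  intro s hs
  have hr : 0 < √s := Real.sqrt_pos.2 hs
  have hc (k : ℕ) : 0 < √2 * x * (k + q) := by positivity
  have L (k : ℕ) := levy (√2 * x * (k + q)) (√s) (hc k) hr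
  set y := x * √(2 * s) with hy
  have hypos : 0 < y := by positivity
  have hy2 (k : ℕ) : 2 * (√2 * x * (k + q)) * √s = 2 * y * (k + q) := by
    rw [hy, Real.sqrt_mul (by norm_num)]; ring
  set C := (2 : ℝ) ^ (2 * q) * π ^ (-(1 / 2 : ℝ)) with hC
  have hCpos : 0 < C := by positivity
  let G : ℕ → ℝ → ℝ := fun k t => √2 * x * (k + q) * t ^ (-(3 / 2 : ℝ)) *
    Real.exp (-((√2 * x * (k + q)) ^ 2 / t) - √s ^ 2 * t)
  let F : ℕ → ℝ → ℝ := fun k t => (C * genBinom (-(2 * q)) k) * G k t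
  have hFint (k : ℕ) : Integrable (F k) (volume.restrict (Ioi 0)) := (L k).1.const_mul _
  have hG (k : ℕ) : ∫ t in Ioi (0:ℝ), G k t = √π * Real.exp (-(2 * y * (k + q))) := by
    rw [← hy2]; exact (L k).2
  have hz : |Real.exp (-(2 * y))| < 1 := by
    rw [abs_of_pos (Real.exp_pos _)]; exact Real.exp_lt_one_iff.2 (by linarith)
  have hsum := hasSum_genBinom (-(2 * q)) _ hz
  have hpi : π ^ (-(1 / 2 : ℝ)) * √π = 1 := by
    rw [Real.sqrt_eq_rpow, ← Real.rpow_add Real.pi_pos]; simp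
  have hexp (k : ℕ) : Real.exp (-(2 * y * (k + q)))
      = Real.exp (-(2 * y)) ^ k * Real.exp (-(2 * y * q)) := by
    rw [← Real.exp_nat_mul, ← Real.exp_add]; ring_nf
  have hFI (k : ℕ) : ∫ t in Ioi (0:ℝ), F k t =
      (2 ^ (2 * q) * Real.exp (-(2 * y * q))) *
        (genBinom (-(2 * q)) k * Real.exp (-(2 * y)) ^ k) := by
    simp only [F]
    rw [integral_const_mul, hG, hexp, hC]
    linear_combination (2 ^ (2 * q) * Real.exp (-(2 * y * q)) *
        (genBinom (-(2 * q)) k * Real.exp (-(2 * y)) ^ k)) * hpi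
  have hFn (k : ℕ) : ∫ t in Ioi (0:ℝ), ‖F k t‖ = |∫ t in Ioi (0:ℝ), F k t| := by
    have : ∫ t in Ioi (0:ℝ), ‖F k t‖
        = ∫ t in Ioi (0:ℝ), |C * genBinom (-(2 * q)) k| * G k t := by
      refine setIntegral_congr_fun measurableSet_Ioi fun t ht => ?_
      have ht : 0 < t := ht
      have : 0 ≤ G k t := by simp only [G]; positivity
      simp only [F]
      rw [Real.norm_eq_abs, abs_mul, abs_of_nonneg this]
    rw [this]
    simp only [F]
    rw [integral_const_mul, integral_const_mul, hG, abs_mul (C * _),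
      abs_of_pos (a := √π * _) (by positivity)]
  have hFs : HasSum (fun k => ∫ t in Ioi (0:ℝ), F k t) _ :=
    (hsum.mul_left (2 ^ (2 * q) * Real.exp (-(2 * y * q)))).congr_fun hFI
  have hswap := hasSum_integral_of_summable_integral_norm hFint (by
    simp only [hFn]; exact hFs.summable.abs)
  have hEq : ∫ t in Ioi (0:ℝ), Real.exp (-(s * t)) * fpDensity q x t
      = ∫ t in Ioi (0:ℝ), ∑' k, F k t := by
    refine setIntegral_congr_fun measurableSet_Ioi fun t ht => ?_
    have h2 : √2 ^ 2 = 2 := Real.sq_sqrt (by norm_num)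
    have h3 : √s ^ 2 = s := Real.sq_sqrt hs.le
    simp only [fpDensity]
    rw [← mul_assoc, ← tsum_mul_left]
    refine tsum_congr fun k => ?_
    simp only [F, G, hC]
    rw [h3, mul_pow, mul_pow, h2, sub_eq_add_neg, Real.exp_add]
    ring
  have hval : ∫ t in Ioi (0:ℝ), Real.exp (-(s * t)) * fpDensity q x t
      = Real.cosh y ^ (-(2 * q)) := by
    rw [hEq, hswap.unique hFs]
    have e1 : Real.exp (-(2 * y * q)) = Real.exp y ^ (-(2 * q)) := by
      rw [← Real.exp_mul]; ring_nf
    have e2 : (2:ℝ) ^ (2 * q) = (1 / 2 : ℝ) ^ (-(2 * q)) := by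
      rw [one_div, Real.inv_rpow (by norm_num), Real.rpow_neg (by norm_num), inv_inv]
    rw [e1, e2, ← Real.mul_rpow (by norm_num) (Real.exp_pos _).le,
      ← Real.mul_rpow (by positivity) (by positivity), Real.cosh_eq]
    congr 1
    have : Real.exp (-y) = Real.exp y * Real.exp (-(2 * y)) := by
      rw [← Real.exp_add]; ring_nf
    rw [this]
    ring
  refine ⟨?_, hval⟩
  by_contra hn
  rw [integral_undef hn] at hval
  have := Real.rpow_pos_of_pos (Real.cosh_pos y) (-(2 * q))
  linarith
end

section
/- Fix real numbers q with 0 < q < 1 and x > 0, and let f_{q,x}(t) = 2^{2q} √2 x π^{-1/2} t^{-3/2} ∑_{k=0}^∞ C(-2q, k)(k+q) e^{-2x²(k+q)²/t} for t > 0. Then the integral ∫_0^∞ t · f_{q,x}(t) dt converges and equals 2 q x². (That is, the mean first-passage time of the 1-excited walk to the last cookie at distance x equals 2qx².) -/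
open scoped Real
open MeasureTheory

lemma gb_succ (b : ℝ) (k : ℕ) :
    ((k : ℝ) + 1) * genBinom (-b) (k + 1) = -(b + k) * genBinom (-b) k := by
  unfold genBinom
  rw [Finset.prod_range_succ, Nat.factorial_succ]
  have : (Nat.factorial k : ℝ) ≠ 0 := by positivity
  push_cast
  field_simp
  ring

lemma gb_zero (b : ℝ) : genBinom (-b) 0 = 1 := by simp [genBinom]

/-- Pascal: coefficients of `(1+z)^(1-b)` -/
lemma gb_pascal (b : ℝ) (k : ℕ) :
    genBinom (-(b - 1)) (k + 1) = genBinom (-b) (k + 1) + genBinom (-b) k := by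
  have h : ∀ k : ℕ, (1 - b - k) * genBinom (-(b - 1)) k = (1 - b) * genBinom (-b) k := by
    intro k
    induction k with
    | zero => simp [genBinom]
    | succ k ih =>
      have h1 := gb_succ b k
      have h2 := gb_succ (b - 1) k
      have h3 : (k : ℝ) + 1 ≠ 0 := by positivity
      apply mul_left_cancel₀ h3
      push_cast
      linear_combination (1 - b - k - 1) * h2 - (1 - b) * h1 - (b + k) * ih
  have h3 : (k : ℝ) + 1 ≠ 0 := by positivity
  apply mul_left_cancel₀ h3
  have h1 := gb_succ b k
  have h2 := gb_succ (b - 1) k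
  linear_combination h2 - h1 + h k

lemma bern (b x : ℝ) (hx : 0 ≤ x) : 1 + (b - 1) * x ≤ (1 + x) ^ b := by
  rcases le_total b 0 with hb | hb
  · have h1 : (1 + x) ^ b = Real.exp (Real.log (1 + x) * b) := Real.rpow_def_of_pos (by linarith) _
    have h2 := Real.add_one_le_exp (Real.log (1 + x) * b)
    have h3 := Real.log_le_sub_one_of_pos (show 0 < 1 + x by linarith)
    rw [h1]
    nlinarith
  · rcases le_total b 1 with hb1 | hb1
    · have : 1 ≤ (1 + x) ^ b := Real.one_le_rpow (by linarith) hb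
      nlinarith
    · have := one_add_mul_self_le_rpow_one_add (show -1 ≤ x by linarith) hb1
      nlinarith

lemma gb_bound (b : ℝ) : ∃ C : ℝ, 0 ≤ C ∧ ∀ k : ℕ, |genBinom (-b) k| ≤ C * ((k : ℝ) + 1) ^ b := by
  obtain ⟨K, hK⟩ := exists_nat_ge (-b)
  have hnn : ∀ j ∈ Finset.range (K + 1), 0 ≤ |genBinom (-b) j| / ((j : ℝ) + 1) ^ b := by
    intro j _
    positivity
  refine ⟨∑ j ∈ Finset.range (K + 1), |genBinom (-b) j| / ((j : ℝ) + 1) ^ b,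
    Finset.sum_nonneg hnn, ?_⟩
  set C := ∑ j ∈ Finset.range (K + 1), |genBinom (-b) j| / ((j : ℝ) + 1) ^ b with hC
  have hC0 : 0 ≤ C := Finset.sum_nonneg hnn
  have small : ∀ k : ℕ, k ≤ K → |genBinom (-b) k| ≤ C * ((k : ℝ) + 1) ^ b := by
    intro k hk
    have := Finset.single_le_sum hnn (Finset.mem_range.2 (Nat.lt_succ_of_le hk))
    rwa [div_le_iff₀ (by positivity)] at this
  intro k
  induction k with
  | zero => exact small 0 (Nat.zero_le _)
  | succ k ih =>
    by_cases hk : k + 1 ≤ K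
    · exact small _ hk
    · have hkK : (K : ℝ) ≤ k := by exact_mod_cast (by omega : K ≤ k)
      have h1 := gb_succ b k
      have hk0 : (0 : ℝ) < (k : ℝ) + 1 := by positivity
      have h2 : |genBinom (-b) (k + 1)| = (b + k) / (k + 1) * |genBinom (-b) k| := by
        have : genBinom (-b) (k + 1) = -((b + k) / (k + 1)) * genBinom (-b) k := by
          field_simp
          linarith
        rw [this, abs_mul, abs_neg, abs_of_nonneg (div_nonneg (by linarith) hk0.le)]
      have h3 : (b + k) / (k + 1) ≤ (1 + 1 / ((k : ℝ) + 1)) ^ b := by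
        have := bern b (1 / ((k : ℝ) + 1)) (by positivity)
        refine le_trans (le_of_eq ?_) this
        field_simp
        ring
      rw [h2]
      push_cast
      have h4 : ((k : ℝ) + 1 + 1) ^ b = (1 + 1 / ((k : ℝ) + 1)) ^ b * ((k : ℝ) + 1) ^ b := by
        rw [← Real.mul_rpow (by positivity) (by positivity)]
        congr 1
        field_simp
      rw [h4]
      calc _ ≤ (1 + 1 / ((k : ℝ) + 1)) ^ b * (C * ((k : ℝ) + 1) ^ b) := by gcongr
        _ = _ := by ring

/-- building block functions -/
noncomputable def phi (p : ℝ) (i : ℕ) (μ y : ℝ) : ℝ :=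
  y ^ p * (μ * y ^ 2) ^ i * Real.exp (-(μ * y ^ 2))

lemma phi_bound (p : ℝ) (i : ℕ) (μ y : ℝ) (hμ : 0 ≤ μ) (hy : 0 < y) :
    |phi p i μ y| ≤ (Nat.factorial i) * y ^ p := by
  unfold phi
  have h1 : 0 ≤ μ * y ^ 2 := by positivity
  have h2 := Real.pow_div_factorial_le_exp (μ * y ^ 2) h1 i
  rw [div_le_iff₀ (by positivity)] at h2
  rw [abs_of_nonneg (by positivity), Real.exp_neg, mul_assoc, mul_comm]
  gcongr
  rw [← div_eq_mul_inv, div_le_iff₀ (Real.exp_pos _)]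
  linarith

lemma phi_deriv (p : ℝ) (i : ℕ) (μ y : ℝ) (hy : 0 < y) :
    HasDerivAt (phi p i μ) ((p + 2 * i) * phi (p - 1) i μ y - 2 * phi (p - 1) (i + 1) μ y) y := by
  unfold phi
  have h1 : HasDerivAt (fun y : ℝ => y ^ p) (p * y ^ (p - 1)) y :=
    Real.hasDerivAt_rpow_const (Or.inl hy.ne')
  have h0 : HasDerivAt (fun y : ℝ => μ * y ^ 2) (μ * (2 * y)) y := by
    simpa using (hasDerivAt_pow 2 y).const_mul μ
  have h2 := h0.pow i
  have h3 := h0.neg.exp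
  refine ((h1.mul h2).mul h3).congr_deriv ?_
  have h5 : y ^ p = y ^ (p - 1) * y := by
    rw [← Real.rpow_add_one hy.ne']; ring_nf
  simp only [Pi.mul_apply, Pi.pow_apply, Pi.neg_apply]
  rw [h5]
  rcases i with _ | i
  · simp; ring
  · push_cast
    ring

lemma phi_deriv_mu (p μ y : ℝ) (hy : 0 < y) :
    HasDerivAt (fun m => phi p 0 m y) (-phi (p + 2) 0 μ y) μ := by
  unfold phi
  have h0 : HasDerivAt (fun m : ℝ => m * y ^ 2) (y ^ 2) μ := by
    simpa using (hasDerivAt_id μ).mul_const (y ^ 2)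
  have h3 := h0.neg.exp.const_mul (y ^ p)
  have h5 : y ^ (p + 2) = y ^ p * y ^ 2 := by
    rw [Real.rpow_add hy]; norm_num
  simp only [pow_zero, mul_one]
  refine h3.congr_deriv ?_
  rw [h5]
  simp only [Pi.neg_apply]
  ring

lemma ypow (p α B : ℝ) (hα : 0 < α) : ∃ C : ℝ, 0 ≤ C ∧ ∀ s ∈ Set.Icc α B, ∀ k : ℕ,
    ((k : ℝ) + s) ^ p ≤ C * ((k : ℝ) + 1) ^ p := by
  refine ⟨(|B| + 1) ^ p + (min α 1) ^ p, ?_, ?_⟩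
  · have : 0 < min α 1 := lt_min hα one_pos
    positivity
  intro s hs k
  have hm : 0 < min α 1 := lt_min hα one_pos
  have hk : (0 : ℝ) ≤ k := by positivity
  have hs0 : 0 < s := lt_of_lt_of_le hα hs.1
  rcases le_total 0 p with hp | hp
  · have : (k : ℝ) + s ≤ (|B| + 1) * (k + 1) := by
      have := hs.2.trans (le_abs_self B)
      nlinarith [abs_nonneg B, mul_nonneg (abs_nonneg B) hk]
    calc ((k : ℝ) + s) ^ p ≤ ((|B| + 1) * (k + 1)) ^ p := by gcongr
      _ = (|B| + 1) ^ p * ((k : ℝ) + 1) ^ p := Real.mul_rpow (by positivity) (by positivity)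
      _ ≤ _ := by gcongr; linarith [Real.rpow_nonneg hm.le p]
  · have : min α 1 * (k + 1) ≤ (k : ℝ) + s := by
      have h1 := min_le_left α 1
      have h2 := min_le_right α 1
      nlinarith [hs.1]
    calc ((k : ℝ) + s) ^ p ≤ (min α 1 * (k + 1)) ^ p :=
          Real.rpow_le_rpow_of_nonpos (by positivity) this hp
      _ = (min α 1) ^ p * ((k : ℝ) + 1) ^ p := Real.mul_rpow (by positivity) (by positivity)
      _ ≤ _ := by
        gcongr
        have : 0 ≤ (|B| + 1) ^ p := by positivity
        linarith

lemma term_bound (b p : ℝ) (i : ℕ) (α B : ℝ) (hα : 0 < α) : ∃ C : ℝ, 0 ≤ C ∧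
    ∀ μ, 0 ≤ μ → ∀ s ∈ Set.Icc α B, ∀ k : ℕ,
      |genBinom (-b) k * phi p i μ (k + s)| ≤ C * ((k : ℝ) + 1) ^ (b + p) := by
  obtain ⟨C1, h1, H1⟩ := gb_bound b
  obtain ⟨C2, h2, H2⟩ := ypow p α B hα
  refine ⟨C1 * (Nat.factorial i * C2), by positivity, ?_⟩
  intro μ hμ s hs k
  have hs0 : 0 < s := lt_of_lt_of_le hα hs.1
  have hy : 0 < (k : ℝ) + s := by positivity
  rw [abs_mul, Real.rpow_add (by positivity)]
  calc _ ≤ (C1 * ((k : ℝ) + 1) ^ b) * (Nat.factorial i * (C2 * ((k : ℝ) + 1) ^ p)) := by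
        gcongr
        · exact H1 k
        · refine (phi_bound p i μ _ hμ hy).trans ?_
          gcongr
          exact H2 s hs k
    _ = _ := by ring

lemma summ_geo (p r : ℝ) (hr : r ∈ Set.Ico (0 : ℝ) 1) :
    Summable fun k : ℕ => ((k : ℝ) + 1) ^ p * r ^ k := by
  obtain ⟨n, hn⟩ := exists_nat_ge p
  rcases eq_or_lt_of_le hr.1 with h0 | h0
  · rw [← summable_nat_add_iff 1]
    simp [← h0]
  have h := summable_pow_mul_geometric_of_norm_lt_one n
    (show ‖r‖ < 1 by rw [Real.norm_of_nonneg hr.1]; exact hr.2)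
  rw [← summable_nat_add_iff 1] at h
  have h' := h.mul_right r⁻¹
  refine Summable.of_nonneg_of_le (fun k => ?_) (fun k => ?_) h'
  · have := hr.1
    positivity
  · rw [pow_succ, mul_assoc, mul_assoc, mul_inv_cancel₀ h0.ne', mul_one]
    have := hr.1
    gcongr
    push_cast
    rw [← Real.rpow_natCast]
    exact Real.rpow_le_rpow_of_exponent_le (by linarith [(Nat.cast_nonneg k : (0:ℝ) ≤ k)]) hn

lemma summ_pow (p : ℝ) (hp : p < -1) : Summable fun k : ℕ => ((k : ℝ) + 1) ^ p := by
  have := (Real.summable_one_div_nat_add_rpow 1 (-p)).2 (by linarith)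
  refine this.congr fun k => ?_
  rw [abs_of_nonneg (by positivity), Real.rpow_neg (by positivity)]
  simp

noncomputable def FF (b p : ℝ) (i : ℕ) (r μ s : ℝ) : ℝ :=
  ∑' k : ℕ, r ^ k * (genBinom (-b) k * phi p i μ (k + s))

lemma FF_summable (b p : ℝ) (i : ℕ) (r μ s : ℝ) (hr : r ∈ Set.Ico (0 : ℝ) 1) (hμ : 0 ≤ μ)
    (hs : 0 < s) : Summable fun k : ℕ => r ^ k * (genBinom (-b) k * phi p i μ (k + s)) := by
  obtain ⟨C, hC, H⟩ := term_bound b p i s s hs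
  refine Summable.of_norm_bounded ((summ_geo (b + p) r hr).mul_left C) fun k => ?_
  rw [Real.norm_eq_abs, abs_mul, abs_of_nonneg (pow_nonneg hr.1 k)]
  have := mul_le_mul_of_nonneg_left (H μ hμ s ⟨le_rfl, le_rfl⟩ k) (pow_nonneg hr.1 k)
  linarith

lemma FF_deriv (b p : ℝ) (i : ℕ) (r μ s : ℝ) (hr : r ∈ Set.Ico (0 : ℝ) 1) (hμ : 0 ≤ μ)
    (hs : 0 < s) : HasDerivAt (FF b p i r μ)
      ((p + 2 * i) * FF b (p - 1) i r μ s - 2 * FF b (p - 1) (i + 1) r μ s) s := by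
  obtain ⟨C, hC, H⟩ := term_bound b (p - 1) i (s / 2) (s + 1) (by linarith)
  obtain ⟨C', hC', H'⟩ := term_bound b (p - 1) (i + 1) (s / 2) (s + 1) (by linarith)
  have hsum : Summable fun k : ℕ =>
      (|p + 2 * i| * C + 2 * C') * (((k : ℝ) + 1) ^ (b + (p - 1)) * r ^ k) :=
    (summ_geo _ r hr).mul_left _
  have key := hasDerivAt_tsum_of_isPreconnected (𝕜 := ℝ)
    (g := fun (k : ℕ) z => r ^ k * (genBinom (-b) k * phi p i μ (k + z)))
    (g' := fun (k : ℕ) z => (p + 2 * i) * (r ^ k * (genBinom (-b) k * phi (p - 1) i μ (k + z)))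
      - 2 * (r ^ k * (genBinom (-b) k * phi (p - 1) (i + 1) μ (k + z))))
    (t := Set.Ioo (s / 2) (s + 1)) (y₀ := s) (y := s)
    hsum isOpen_Ioo isPreconnected_Ioo ?_ ?_ ⟨by linarith, by linarith⟩
    (FF_summable b p i r μ s hr hμ hs) ⟨by linarith, by linarith⟩
  · rw [Summable.tsum_sub ((FF_summable b (p - 1) i r μ s hr hμ hs).mul_left _)
      ((FF_summable b (p - 1) (i + 1) r μ s hr hμ hs).mul_left _), tsum_mul_left, tsum_mul_left]
      at key
    exact key
  · intro k z hz
    have hz0 : 0 < z := by linarith [hz.1]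
    have h := (phi_deriv p i μ (k + z) (by positivity)).comp_const_add (k : ℝ) z
    have h2 := (h.const_mul (genBinom (-b) k)).const_mul (r ^ k)
    refine h2.congr_deriv ?_
    ring
  · intro k z hz
    have hz' : z ∈ Set.Icc (s / 2) (s + 1) := ⟨hz.1.le, hz.2.le⟩
    have e1 := H μ hμ z hz' k
    have e2 := H' μ hμ z hz' k
    have hrk := pow_nonneg hr.1 k
    calc _ ≤ |p + 2 * i| * (r ^ k * |genBinom (-b) k * phi (p - 1) i μ (k + z)|)
          + 2 * (r ^ k * |genBinom (-b) k * phi (p - 1) (i + 1) μ (k + z)|) := by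
          refine (norm_sub_le _ _).trans (le_of_eq ?_)
          rw [Real.norm_eq_abs, Real.norm_eq_abs, abs_mul, abs_mul (r ^ k), abs_mul 2,
            abs_mul (r ^ k), abs_of_nonneg hrk, abs_of_nonneg (zero_le_two (α := ℝ))]
      _ ≤ |p + 2 * i| * (r ^ k * (C * ((k : ℝ) + 1) ^ (b + (p - 1))))
          + 2 * (r ^ k * (C' * ((k : ℝ) + 1) ^ (b + (p - 1)))) := by gcongr
      _ = _ := by ring

lemma FF_rec (b p : ℝ) (i : ℕ) (r μ s : ℝ) (hr : r ∈ Set.Ico (0 : ℝ) 1) (hμ : 0 ≤ μ)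
    (hs : 0 < s) : FF (b - 1) p i r μ s = FF b p i r μ s + r * FF b p i r μ (s + 1) := by
  have h1 := FF_summable (b - 1) p i r μ s hr hμ hs
  have h2 := FF_summable b p i r μ s hr hμ hs
  have h3 := FF_summable b p i r μ (s + 1) hr hμ (by linarith)
  unfold FF
  rw [h1.tsum_eq_zero_add, h2.tsum_eq_zero_add, add_assoc, ← tsum_mul_left,
    ← Summable.tsum_add ((summable_nat_add_iff 1).2 h2) (h3.mul_left r)]
  refine congrArg₂ _ ?_ ?_
  · simp only [gb_zero]
  · refine tsum_congr fun k => ?_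
    rw [gb_pascal]
    push_cast
    rw [show (k : ℝ) + 1 + s = k + (s + 1) by ring]
    ring

lemma FF_main (N : ℕ) : ∀ (b p : ℝ) (i : ℕ) (α B : ℝ), 0 < α → b + p < N - 1 →
    ∃ C : ℝ, ∀ r ∈ Set.Ico (0 : ℝ) 1, ∀ μ, 0 ≤ μ → ∀ s ∈ Set.Icc α B, |FF b p i r μ s| ≤ C := by
  induction N with
  | zero =>
    intro b p i α B hα hbp
    obtain ⟨C, hC, H⟩ := term_bound b p i α B hα
    have hs := (summ_pow (b + p) (by simpa using hbp)).mul_left C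
    refine ⟨∑' k : ℕ, C * ((k : ℝ) + 1) ^ (b + p), fun r hr μ hμ s hs' => ?_⟩
    rw [← Real.norm_eq_abs]
    refine tsum_of_norm_bounded hs.hasSum fun k => ?_
    rw [Real.norm_eq_abs, abs_mul, abs_of_nonneg (pow_nonneg hr.1 k)]
    have h1 := H μ hμ s hs' k
    have h2 : r ^ k ≤ 1 := pow_le_one₀ hr.1 hr.2.le
    calc _ ≤ 1 * |genBinom (-b) k * phi p i μ (k + s)| := by gcongr
      _ ≤ _ := by rw [one_mul]; exact h1
  | succ N ih =>
    intro b p i α B hα hbp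
    push_cast at hbp
    obtain ⟨C0, H0⟩ := ih (b - 1) p i α B hα (by linarith)
    obtain ⟨C1, H1⟩ := ih b (p - 1) i α (B + 1) hα (by linarith)
    obtain ⟨C2, H2⟩ := ih b (p - 1) (i + 1) α (B + 1) hα (by linarith)
    refine ⟨C0 + (|p + 2 * i| * C1 + 2 * C2), fun r hr μ hμ s hs => ?_⟩
    have hs0 : 0 < s := lt_of_lt_of_le hα hs.1
    obtain ⟨c, hc, hce⟩ := exists_hasDerivAt_eq_slope (FF b p i r μ)
      (fun s => (p + 2 * i) * FF b (p - 1) i r μ s - 2 * FF b (p - 1) (i + 1) r μ s)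
      (show s < s + 1 by linarith)
      (fun z hz => (FF_deriv b p i r μ z hr hμ (by linarith [hz.1])).continuousAt.continuousWithinAt)
      (fun z hz => FF_deriv b p i r μ z hr hμ (by linarith [hz.1]))
    have hcc : c ∈ Set.Icc α (B + 1) := ⟨by linarith [hc.1, hs.1], by linarith [hc.2, hs.2]⟩
    have hd : |FF b p i r μ (s + 1) - FF b p i r μ s| ≤ |p + 2 * i| * C1 + 2 * C2 := by
      have : FF b p i r μ (s + 1) - FF b p i r μ s =
          (p + 2 * i) * FF b (p - 1) i r μ c - 2 * FF b (p - 1) (i + 1) r μ c := by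
        simpa using hce.symm
      rw [this]
      refine (abs_sub _ _).trans ?_
      rw [abs_mul, abs_mul, abs_of_nonneg (zero_le_two (α := ℝ))]
      gcongr
      · exact H1 r hr μ hμ c hcc
      · exact H2 r hr μ hμ c hcc
    have hrec := FF_rec b p i r μ s hr hμ hs0
    have h0 := H0 r hr μ hμ s hs
    have hr0 := hr.1
    have e : (1 + r) * FF b p i r μ s =
      FF (b - 1) p i r μ s - r * (FF b p i r μ (s + 1) - FF b p i r μ s) := by
      rw [hrec]; ring
    have e2 : |(1 + r) * FF b p i r μ s| ≤ C0 + 1 * (|p + 2 * i| * C1 + 2 * C2) := by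
      rw [e]
      refine (abs_sub _ _).trans ?_
      rw [abs_mul, abs_of_nonneg hr0]
      gcongr
      exact hr.2.le
    rw [abs_mul, abs_of_nonneg (by linarith)] at e2
    nlinarith [abs_nonneg (FF b p i r μ s)]

lemma J_int0 (b : ℝ) (hb : 0 < b) :
    IntegrableOn (fun t : ℝ => t ^ (-(3 / 2 : ℝ)) * Real.exp (-(b / t))) (Set.Ioi 0) ∧
    ∫ t in Set.Ioi (0 : ℝ), t ^ (-(3 / 2 : ℝ)) * Real.exp (-(b / t)) = √(π / b) := by
  have hI : ∫ u in Set.Ioi (0 : ℝ), u ^ ((1 / 2 : ℝ) - 1) * Real.exp (-(b * u)) = √(π / b) := by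
    rw [Real.integral_rpow_mul_exp_neg_mul_Ioi (by norm_num) hb, Real.Gamma_one_half_eq,
      ← Real.sqrt_eq_rpow, ← Real.sqrt_mul (by positivity)]
    congr 1
    ring
  have hint : IntegrableOn (fun u : ℝ => u ^ ((1 / 2 : ℝ) - 1) * Real.exp (-(b * u)))
      (Set.Ioi 0) := by
    by_contra h
    rw [integral_undef h] at hI
    have : 0 < √(π / b) := Real.sqrt_pos.2 (by positivity)
    linarith
  have hcongr : ∀ t ∈ Set.Ioi (0 : ℝ), (|(-1 : ℝ)| * t ^ ((-1 : ℝ) - 1)) •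
      ((t ^ (-1 : ℝ)) ^ ((1 / 2 : ℝ) - 1) * Real.exp (-(b * t ^ (-1 : ℝ)))) =
      t ^ (-(3 / 2 : ℝ)) * Real.exp (-(b / t)) := by
    intro t ht
    have ht : 0 < t := ht
    rw [← Real.rpow_mul ht.le, smul_eq_mul, abs_neg, abs_one, one_mul, ← mul_assoc,
      ← Real.rpow_add ht, Real.rpow_neg_one, div_eq_mul_inv b t]
    norm_num
  have h1 := (integrableOn_Ioi_comp_rpow_iff
    (fun u : ℝ => u ^ ((1 / 2 : ℝ) - 1) * Real.exp (-(b * u))) (p := -1) (by norm_num)).2 hint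
  have h2 := integral_comp_rpow_Ioi
    (fun u : ℝ => u ^ ((1 / 2 : ℝ) - 1) * Real.exp (-(b * u))) (p := -1) (by norm_num)
  rw [hI, setIntegral_congr_fun measurableSet_Ioi hcongr] at h2
  exact ⟨h1.congr_fun hcongr measurableSet_Ioi, h2⟩

lemma J_integrable (b : ℝ) (hb : 0 < b) :
    IntegrableOn (fun t : ℝ => t ^ (-(1 / 2 : ℝ)) * (1 - Real.exp (-(b / t)))) (Set.Ioi 0) := by
  have hm : Measurable (fun t : ℝ => t ^ (-(1 / 2 : ℝ)) * (1 - Real.exp (-(b / t)))) := by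
    fun_prop
  rw [← Set.Ioc_union_Ioi_eq_Ioi (zero_le_one (α := ℝ))]
  refine IntegrableOn.union ?_ ?_
  · have h1 : IntegrableOn (fun t : ℝ => t ^ (-(1 / 2 : ℝ))) (Set.Ioc 0 1) := by
      rw [← intervalIntegrable_iff_integrableOn_Ioc_of_le zero_le_one]
      exact intervalIntegral.intervalIntegrable_rpow' (by norm_num)
    refine Integrable.mono' h1 hm.aestronglyMeasurable ?_
    refine (ae_restrict_iff' measurableSet_Ioc).2 (Filter.Eventually.of_forall fun t ht => ?_)
    have ht0 : 0 < t := ht.1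
    have e1 := Real.exp_pos (-(b / t))
    have e2 : Real.exp (-(b / t)) ≤ 1 := Real.exp_le_one_iff.2 (by
      have : 0 < b / t := by positivity
      linarith)
    have e3 : 0 ≤ t ^ (-(1 / 2 : ℝ)) := by positivity
    rw [Real.norm_of_nonneg (mul_nonneg e3 (by linarith))]
    nlinarith
  · have h1 : IntegrableOn (fun t : ℝ => b * t ^ (-(3 / 2 : ℝ))) (Set.Ioi 1) :=
      (integrableOn_Ioi_rpow_of_lt (by norm_num) one_pos).const_mul b
    refine Integrable.mono' h1 hm.aestronglyMeasurable ?_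
    refine (ae_restrict_iff' measurableSet_Ioi).2 (Filter.Eventually.of_forall fun t ht => ?_)
    have ht0 : 0 < t := one_pos.trans ht
    have e2 : Real.exp (-(b / t)) ≤ 1 := Real.exp_le_one_iff.2 (by
      have : 0 < b / t := by positivity
      linarith)
    have e3 : 0 ≤ t ^ (-(1 / 2 : ℝ)) := by positivity
    have e4 := Real.add_one_le_exp (-(b / t))
    rw [Real.norm_of_nonneg (mul_nonneg e3 (by linarith))]
    have e5 : t ^ (-(3 / 2 : ℝ)) = t ^ (-(1 / 2 : ℝ)) * t⁻¹ := by
      rw [← Real.rpow_neg_one, ← Real.rpow_add ht0]; norm_num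
    calc _ ≤ t ^ (-(1 / 2 : ℝ)) * (b / t) := by gcongr; linarith
      _ = _ := by rw [e5]; ring

lemma J_integral (b : ℝ) (hb : 0 < b) :
    ∫ t in Set.Ioi (0 : ℝ), t ^ (-(1 / 2 : ℝ)) * (1 - Real.exp (-(b / t))) = 2 * √(π * b) := by
  obtain ⟨hA, hA'⟩ := J_int0 b hb
  have hB := J_integrable b hb
  have hbd : ∀ t : ℝ, 0 < t → 0 ≤ 1 - Real.exp (-(b / t)) ∧ 1 - Real.exp (-(b / t)) ≤ 1 ∧
      1 - Real.exp (-(b / t)) ≤ b / t := by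
    intro t ht
    have : 0 < b / t := by positivity
    have e2 : Real.exp (-(b / t)) ≤ 1 := Real.exp_le_one_iff.2 (by linarith)
    have e4 := Real.add_one_le_exp (-(b / t))
    have e1 := Real.exp_pos (-(b / t))
    exact ⟨by linarith, by linarith, by linarith⟩
  have key := integral_Ioi_of_hasDerivAt_of_tendsto (a := 0) (m := 0)
    (f := fun t : ℝ => 2 * t ^ (1 / 2 : ℝ) * (1 - Real.exp (-(b / t))))
    (f' := fun t : ℝ => t ^ (-(1 / 2 : ℝ)) * (1 - Real.exp (-(b / t))) -
      2 * b * (t ^ (-(3 / 2 : ℝ)) * Real.exp (-(b / t)))) ?_ ?_ (hB.sub (hA.const_mul (2 * b))) ?_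
  · rw [integral_sub hB (hA.const_mul (2 * b)), integral_const_mul, hA'] at key
    have hs : b * √(π / b) = √(π * b) := by
      have : √(π * b) = √(b ^ 2 * (π / b)) := by congr 1; field_simp
      rw [this, Real.sqrt_mul (by positivity), Real.sqrt_sq hb.le]
    have z : (0 : ℝ) ^ (1 / 2 : ℝ) = 0 := Real.zero_rpow (by norm_num)
    rw [z] at key
    linarith
  · have z : (0 : ℝ) ^ (1 / 2 : ℝ) = 0 := Real.zero_rpow (by norm_num)
    have hc : ContinuousWithinAt (fun t : ℝ => 2 * t ^ (1 / 2 : ℝ)) (Set.Ici 0) 0 :=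
      ((Real.continuousAt_rpow_const 0 (1 / 2) (Or.inr (by norm_num))).const_mul 2
        ).continuousWithinAt
    unfold ContinuousWithinAt at hc ⊢
    simp only [z, mul_zero, zero_mul] at hc ⊢
    refine tendsto_of_tendsto_of_tendsto_of_le_of_le' tendsto_const_nhds hc ?_ ?_
    · filter_upwards [self_mem_nhdsWithin] with t ht
      rcases eq_or_lt_of_le (show (0 : ℝ) ≤ t from ht) with h | h
      · simp [← h]
      · exact mul_nonneg (by positivity) (hbd t h).1
    · filter_upwards [self_mem_nhdsWithin] with t ht
      rcases eq_or_lt_of_le (show (0 : ℝ) ≤ t from ht) with h | h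
      · simp [← h]
      · exact mul_le_of_le_one_right (by positivity) (hbd t h).2.1
  · intro t ht
    have ht : 0 < t := ht
    have h1 : HasDerivAt (fun y : ℝ => y ^ (1 / 2 : ℝ)) ((1 / 2) * t ^ ((1 / 2 : ℝ) - 1)) t :=
      Real.hasDerivAt_rpow_const (Or.inl ht.ne')
    have h2 : HasDerivAt (fun y : ℝ => b / y) (-(b / t ^ 2)) t := by
      have := (hasDerivAt_inv ht.ne').const_mul b
      simp only [← div_eq_mul_inv] at this
      refine this.congr_deriv ?_
      ring
    have h3 := (h1.const_mul 2).mul (h2.neg.exp.const_sub 1)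
    refine h3.congr_deriv ?_
    have e5 : t ^ (-(3 / 2 : ℝ)) = t ^ (1 / 2 : ℝ) * (t ^ 2)⁻¹ := by
      rw [← Real.rpow_natCast, ← Real.rpow_neg ht.le, ← Real.rpow_add ht]; norm_num
    rw [e5, show (1 / 2 : ℝ) - 1 = -(1 / 2) by norm_num]
    simp only [Pi.neg_apply]
    ring
  · have h0 : Filter.Tendsto (fun t : ℝ => 2 * b * t ^ (-(1 / 2 : ℝ))) Filter.atTop (nhds 0) := by
      simpa using (tendsto_rpow_neg_atTop (show (0 : ℝ) < 1 / 2 by norm_num)).const_mul (2 * b)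
    refine tendsto_of_tendsto_of_tendsto_of_le_of_le' tendsto_const_nhds h0 ?_ ?_
    · filter_upwards [Filter.eventually_gt_atTop 0] with t h
      exact mul_nonneg (by positivity) (hbd t h).1
    · filter_upwards [Filter.eventually_gt_atTop 0] with t h
      have e5 : t ^ (-(1 / 2 : ℝ)) = t ^ (1 / 2 : ℝ) * t⁻¹ := by
        rw [← Real.rpow_neg_one, ← Real.rpow_add h]; norm_num
      calc _ ≤ 2 * t ^ (1 / 2 : ℝ) * (b / t) := by gcongr; exact (hbd t h).2.2
        _ = _ := by rw [e5]; ring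

lemma FF_deriv_mu (b p r μ s : ℝ) (hr : r ∈ Set.Ico (0 : ℝ) 1) (hμ : 0 < μ)
    (hs : 0 < s) : HasDerivAt (fun m => FF b p 0 r m s) (-FF b (p + 2) 0 r μ s) μ := by
  obtain ⟨C, hC, H⟩ := term_bound b (p + 2) 0 s s hs
  have key := hasDerivAt_tsum_of_isPreconnected (𝕜 := ℝ)
    (g := fun (k : ℕ) m => r ^ k * (genBinom (-b) k * phi p 0 m (k + s)))
    (g' := fun (k : ℕ) m => -(r ^ k * (genBinom (-b) k * phi (p + 2) 0 m (k + s))))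
    (t := Set.Ioi 0) (y₀ := μ) (y := μ)
    ((summ_geo (b + (p + 2)) r hr).mul_left C) isOpen_Ioi isPreconnected_Ioi ?_ ?_ hμ
    (FF_summable b p 0 r μ s hr hμ.le hs) hμ
  · rw [tsum_neg] at key
    exact key
  · intro k z hz
    have h2 := ((phi_deriv_mu p z (k + s) (by positivity)).const_mul
      (genBinom (-b) k)).const_mul (r ^ k)
    refine h2.congr_deriv ?_
    ring
  · intro k z hz
    rw [norm_neg, Real.norm_eq_abs, abs_mul, abs_of_nonneg (pow_nonneg hr.1 k)]
    have := mul_le_mul_of_nonneg_left (H z (le_of_lt hz) s ⟨le_rfl, le_rfl⟩ k) (pow_nonneg hr.1 k)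
    linarith

lemma FF_cont_mu (b p r s : ℝ) (hr : r ∈ Set.Ico (0 : ℝ) 1)
    (hs : 0 < s) : ContinuousOn (fun m => FF b p 0 r m s) (Set.Ici 0) := by
  obtain ⟨C, hC, H⟩ := term_bound b p 0 s s hs
  refine continuousOn_tsum (fun k => ?_) ((summ_geo (b + p) r hr).mul_left C) ?_
  · unfold phi
    fun_prop
  · intro k z hz
    rw [Real.norm_eq_abs, abs_mul, abs_of_nonneg (pow_nonneg hr.1 k)]
    have := mul_le_mul_of_nonneg_left (H z hz s ⟨le_rfl, le_rfl⟩ k) (pow_nonneg hr.1 k)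
    linarith

lemma FF_diff (b q : ℝ) (hq : 0 < q) : ∃ K : ℝ, 0 ≤ K ∧ ∀ r ∈ Set.Ico (0 : ℝ) 1, ∀ l, 0 < l →
    |FF b 1 0 r 0 q - FF b 1 0 r l q| ≤ K * (1 - Real.exp (-l)) := by
  obtain ⟨N, hN⟩ := exists_nat_gt (b + 4)
  obtain ⟨C1, H1⟩ := FF_main N b 1 0 q q hq (by linarith)
  obtain ⟨C3, H3⟩ := FF_main N b (1 + 2) 0 q q hq (by linarith)
  have hqq : q ∈ Set.Icc q q := ⟨le_rfl, le_rfl⟩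
  have h10 : 0 ≤ C1 := (abs_nonneg _).trans (H1 0 ⟨le_rfl, one_pos⟩ 0 le_rfl q hqq)
  have h30 : 0 ≤ C3 := (abs_nonneg _).trans (H3 0 ⟨le_rfl, one_pos⟩ 0 le_rfl q hqq)
  refine ⟨2 * (2 * C1 + C3), by positivity, fun r hr l hl => ?_⟩
  have a1 : |FF b 1 0 r 0 q - FF b 1 0 r l q| ≤ 2 * C1 := by
    refine (abs_sub _ _).trans ?_
    linarith [H1 r hr 0 le_rfl q hqq, H1 r hr l hl.le q hqq]
  have a2 : |FF b 1 0 r 0 q - FF b 1 0 r l q| ≤ C3 * l := by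
    obtain ⟨c, hc, hce⟩ := exists_hasDerivAt_eq_slope (fun m => FF b 1 0 r m q)
      (fun m => -FF b (1 + 2) 0 r m q) hl
      ((FF_cont_mu b 1 r q hr hq).mono Set.Icc_subset_Ici_self)
      (fun z hz => FF_deriv_mu b 1 r z q hr hz.1 hq)
    rw [eq_div_iff (by linarith)] at hce
    have : FF b 1 0 r 0 q - FF b 1 0 r l q = FF b (1 + 2) 0 r c q * l := by
      linarith
    rw [this, abs_mul, abs_of_pos hl]
    gcongr
    exact H3 r hr c hc.1.le q hqq
  have e : l / (1 + l) ≤ 1 - Real.exp (-l) := by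
    have := Real.add_one_le_exp l
    rw [Real.exp_neg]
    have h2 : (Real.exp l)⁻¹ ≤ (1 + l)⁻¹ := by gcongr; linarith
    have h3 : l / (1 + l) = 1 - (1 + l)⁻¹ := by field_simp; ring
    linarith
  refine le_trans ?_ (mul_le_mul_of_nonneg_left e (by positivity))
  rw [mul_div_assoc', le_div_iff₀ (by linarith)]
  have := abs_nonneg (FF b 1 0 r 0 q - FF b 1 0 r l q)
  rcases le_total l 1 with h | h
  · nlinarith [mul_nonneg h10 hl.le, mul_nonneg h30 hl.le]
  · nlinarith [mul_nonneg h10 hl.le, mul_nonneg h30 hl.le]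

lemma phi_one (μ y : ℝ) : phi 1 0 μ y = y * Real.exp (-(μ * y ^ 2)) := by
  simp [phi]

lemma phi_two (y : ℝ) : phi 2 0 0 y = y ^ 2 := by
  simp [phi]

lemma gb_ring (b : ℝ) (k : ℕ) : genBinom b k = Ring.choose b k := by
  rw [Ring.choose_eq_smul, genBinom, smul_eq_mul, div_eq_inv_mul]
  congr 1
  induction k with
  | zero => simp
  | succ k ih =>
    rw [Finset.prod_range_succ, ih, descPochhammer_succ_right, Polynomial.smeval_mul]
    congr 1
    simp [Polynomial.smeval_sub, Polynomial.smeval_X, Polynomial.smeval_natCast]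

lemma M0_eq (b r : ℝ) (hr : r ∈ Set.Ico (0 : ℝ) 1) :
    HasSum (fun k : ℕ => r ^ k * genBinom (-b) k) ((1 + r) ^ (-b)) := by
  have h := (Real.one_add_rpow_hasFPowerSeriesOnBall_zero (a := -b)).hasSum (y := r) (by
    rw [Metric.mem_eball, edist_dist, ENNReal.ofReal_lt_one, dist_zero_right,
      Real.norm_of_nonneg hr.1]
    exact hr.2)
  simp only [zero_add, binomialSeries_apply] at h
  refine (h.congr_fun ?_)
  intro k
  simp [gb_ring, mul_comm]

lemma geo_j (b r : ℝ) (hr : r ∈ Set.Ico (0 : ℝ) 1) (j : ℕ) :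
    Summable (fun k : ℕ => r ^ k * genBinom (-b) k * (k : ℝ) ^ j) := by
  obtain ⟨C, hC, H⟩ := gb_bound b
  refine Summable.of_norm_bounded ((summ_geo (b + j) r hr).mul_left C) fun k => ?_
  rw [Real.norm_eq_abs, abs_mul, abs_mul, abs_of_nonneg (pow_nonneg hr.1 k),
    abs_of_nonneg (show (0 : ℝ) ≤ (k : ℝ) ^ j by positivity), Real.rpow_add (by positivity),
    Real.rpow_natCast]
  have hr0 := hr.1
  calc _ ≤ r ^ k * (C * ((k : ℝ) + 1) ^ b) * ((k : ℝ) + 1) ^ j := by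
        gcongr
        · exact H k
        · linarith
    _ = _ := by ring

lemma moments (b r : ℝ) (hr : r ∈ Set.Ico (0 : ℝ) 1) :
    (∑' k : ℕ, r ^ k * genBinom (-b) k * (k : ℝ) ^ 1) = -(b * r / (1 + r)) * (1 + r) ^ (-b) ∧
    (∑' k : ℕ, r ^ k * genBinom (-b) k * (k : ℝ) ^ 2) =
      -(r / (1 + r)) * (b - (b + 1) * (b * r / (1 + r))) * (1 + r) ^ (-b) := by
  have s0 := M0_eq b r hr
  have s1 := geo_j b r hr 1
  have s2 := geo_j b r hr 2
  have e0 : (0 : ℝ) < 1 + r := by linarith [hr.1]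
  have t1 : (∑' k : ℕ, r ^ k * genBinom (-b) k * (k : ℝ) ^ 1) =
      -r * (b * (1 + r) ^ (-b) + ∑' k : ℕ, r ^ k * genBinom (-b) k * (k : ℝ) ^ 1) := by
    rw [← s0.tsum_eq, ← tsum_mul_left, ← Summable.tsum_add (s0.summable.mul_left b) s1,
      ← tsum_mul_left, s1.tsum_eq_zero_add]
    simp only [Nat.cast_zero, pow_one, mul_zero, zero_add]
    refine tsum_congr fun k => ?_
    have := gb_succ b k
    push_cast
    linear_combination r ^ (k + 1) * this
  have t2 : (∑' k : ℕ, r ^ k * genBinom (-b) k * (k : ℝ) ^ 2) =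
      -r * (b * (1 + r) ^ (-b) + (b + 1) * (∑' k : ℕ, r ^ k * genBinom (-b) k * (k : ℝ) ^ 1)
        + ∑' k : ℕ, r ^ k * genBinom (-b) k * (k : ℝ) ^ 2) := by
    rw [← s0.tsum_eq, ← tsum_mul_left, ← tsum_mul_left,
      ← Summable.tsum_add (s0.summable.mul_left b) (s1.mul_left (b + 1)),
      ← Summable.tsum_add ((s0.summable.mul_left b).add (s1.mul_left (b + 1))) s2,
      ← tsum_mul_left, s2.tsum_eq_zero_add]
    simp only [Nat.cast_zero, ne_eq, OfNat.ofNat_ne_zero, not_false_eq_true, zero_pow,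
      mul_zero, zero_add]
    refine tsum_congr fun k => ?_
    have := gb_succ b k
    push_cast
    linear_combination r ^ (k + 1) * (k + 1) * this
  have u1 : (∑' k : ℕ, r ^ k * genBinom (-b) k * (k : ℝ) ^ 1) =
      -(b * r / (1 + r)) * (1 + r) ^ (-b) := by
    rw [show -(b * r / (1 + r)) * (1 + r) ^ (-b) = -(b * r * (1 + r) ^ (-b)) / (1 + r) by ring,
      eq_div_iff e0.ne']
    linear_combination t1
  refine ⟨u1, ?_⟩
  rw [u1] at t2
  field_simp at t2 ⊢
  linear_combination t2

lemma FF1_zero (q r : ℝ) (hr : r ∈ Set.Ico (0 : ℝ) 1) :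
    FF (2 * q) 1 0 r 0 q = (q - 2 * q * r / (1 + r)) * (1 + r) ^ (-(2 * q)) := by
  have s0 := M0_eq (2 * q) r hr
  have s1 := geo_j (2 * q) r hr 1
  have : FF (2 * q) 1 0 r 0 q = (∑' k : ℕ, r ^ k * genBinom (-(2 * q)) k * (k : ℝ) ^ 1)
      + q * ∑' k : ℕ, r ^ k * genBinom (-(2 * q)) k := by
    rw [← tsum_mul_left, ← Summable.tsum_add s1 (s0.summable.mul_left q)]
    refine tsum_congr fun k => ?_
    rw [phi_one]
    simp
    ring
  rw [this, (moments (2 * q) r hr).1, s0.tsum_eq]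
  ring

lemma FF2_zero (q r : ℝ) (hr : r ∈ Set.Ico (0 : ℝ) 1) :
    FF (2 * q) 2 0 r 0 q = (-(r / (1 + r)) * (2 * q - (2 * q + 1) * (2 * q * r / (1 + r)))
      - 2 * q * (2 * q * r / (1 + r)) + q ^ 2) * (1 + r) ^ (-(2 * q)) := by
  have s0 := M0_eq (2 * q) r hr
  have s1 := geo_j (2 * q) r hr 1
  have s2 := geo_j (2 * q) r hr 2
  have : FF (2 * q) 2 0 r 0 q = (∑' k : ℕ, r ^ k * genBinom (-(2 * q)) k * (k : ℝ) ^ 2)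
      + 2 * q * (∑' k : ℕ, r ^ k * genBinom (-(2 * q)) k * (k : ℝ) ^ 1)
      + q ^ 2 * ∑' k : ℕ, r ^ k * genBinom (-(2 * q)) k := by
    rw [← tsum_mul_left, ← tsum_mul_left, ← Summable.tsum_add s2 (s1.mul_left _),
      ← Summable.tsum_add (s2.add (s1.mul_left _)) (s0.summable.mul_left _)]
    refine tsum_congr fun k => ?_
    rw [phi_two]
    ring
  rw [this, (moments (2 * q) r hr).1, (moments (2 * q) r hr).2, s0.tsum_eq]
  ring

lemma gauss_summable (b q l : ℝ) (hq : 0 < q) (hl : 0 < l) :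
    Summable fun k : ℕ => |genBinom (-b) k * phi 1 0 l (k + q)| := by
  obtain ⟨C, hC, H⟩ := term_bound b 1 0 q q hq
  have hρ : Real.exp (-(2 * l * q)) ∈ Set.Ico (0 : ℝ) 1 :=
    ⟨(Real.exp_pos _).le, by
      rw [← Real.exp_zero]
      apply Real.exp_lt_exp.2
      have : 0 < 2 * l * q := by positivity
      linarith⟩
  refine Summable.of_nonneg_of_le (fun k => abs_nonneg _) (fun k => ?_)
    ((summ_geo (b + 1) _ hρ).mul_left C)
  have h0 := H 0 le_rfl q ⟨le_rfl, le_rfl⟩ k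
  have e : phi 1 0 l (k + q) = phi 1 0 0 (k + q) * Real.exp (-(l * (k + q) ^ 2)) := by
    simp [phi_one]
  have e2 : Real.exp (-(l * (k + q) ^ 2)) ≤ Real.exp (-(2 * l * q)) ^ k := by
    rw [← Real.exp_nat_mul]
    apply Real.exp_le_exp.2
    nlinarith [mul_nonneg hl.le (sq_nonneg (k : ℝ)), mul_nonneg hl.le (sq_nonneg q)]
  rw [e, ← mul_assoc, abs_mul, abs_of_pos (Real.exp_pos _), ← mul_assoc]
  gcongr

lemma D_integral (b q β r : ℝ) (hq : 0 < q) (hβ : 0 < β) (hr : r ∈ Set.Ico (0 : ℝ) 1) :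
    ∫ t in Set.Ioi (0 : ℝ), t ^ (-(1 / 2 : ℝ)) * (FF b 1 0 r 0 q - FF b 1 0 r (β / t) q) =
      2 * √(π * β) * FF b 2 0 r 0 q := by
  have hJ : ∀ k : ℕ, (2 : ℝ) * √(π * (β * (k + q) ^ 2)) = 2 * √(π * β) * (k + q) := by
    intro k
    rw [← mul_assoc, Real.sqrt_mul (by positivity), Real.sqrt_sq (by positivity), mul_assoc]
  have hb : ∀ k : ℕ, 0 < β * ((k : ℝ) + q) ^ 2 := fun k => by positivity
  have h := hasSum_integral_of_summable_integral_norm (μ := volume.restrict (Set.Ioi (0 : ℝ)))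
    (F := fun (k : ℕ) (t : ℝ) => (r ^ k * (genBinom (-b) k * (k + q))) *
      (t ^ (-(1 / 2 : ℝ)) * (1 - Real.exp (-(β * (k + q) ^ 2 / t))))) ?_ ?_
  · simp only [integral_const_mul, J_integral _ (hb _), hJ] at h
    have h2 : (∑' k : ℕ, r ^ k * (genBinom (-b) k * (k + q)) * (2 * √(π * β) * (k + q))) =
        2 * √(π * β) * FF b 2 0 r 0 q := by
      unfold FF
      rw [← tsum_mul_left]
      refine tsum_congr fun k => ?_
      rw [phi_two]
      ring
    rw [← h2, h.tsum_eq]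
    refine setIntegral_congr_fun measurableSet_Ioi fun t ht => ?_
    have ht : 0 < t := ht
    have hs := FF_summable b 1 0 r 0 q hr le_rfl hq
    have hs' := FF_summable b 1 0 r (β / t) q hr (by positivity) hq
    simp only [FF]
    rw [← Summable.tsum_sub hs hs', ← tsum_mul_left]
    refine tsum_congr fun k => ?_
    rw [phi_one, phi_one, show β / t * ((k : ℝ) + q) ^ 2 = β * (k + q) ^ 2 / t by ring]
    simp
    ring
  · intro k
    exact (J_integrable _ (hb k)).const_mul _
  · have hn : ∀ k : ℕ, ∫ t in Set.Ioi (0 : ℝ), ‖(r ^ k * (genBinom (-b) k * (k + q))) *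
      (t ^ (-(1 / 2 : ℝ)) * (1 - Real.exp (-(β * (k + q) ^ 2 / t))))‖ =
        2 * √(π * β) * ‖r ^ k * (genBinom (-b) k * phi 2 0 0 (k + q))‖ := by
      intro k
      have : ∀ t ∈ Set.Ioi (0 : ℝ), ‖(r ^ k * (genBinom (-b) k * (k + q))) *
          (t ^ (-(1 / 2 : ℝ)) * (1 - Real.exp (-(β * (k + q) ^ 2 / t))))‖ =
          ‖r ^ k * (genBinom (-b) k * (k + q))‖ *
          (t ^ (-(1 / 2 : ℝ)) * (1 - Real.exp (-(β * (k + q) ^ 2 / t)))) := by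
        intro t ht
        have ht : 0 < t := ht
        rw [norm_mul]
        congr 1
        apply Real.norm_of_nonneg
        have e2 : Real.exp (-(β * (k + q) ^ 2 / t)) ≤ 1 := Real.exp_le_one_iff.2 (by
          have : 0 < β * (k + q) ^ 2 / t := by positivity
          linarith)
        exact mul_nonneg (by positivity) (by linarith)
      rw [setIntegral_congr_fun measurableSet_Ioi this, integral_const_mul, J_integral _ (hb k),
        hJ, phi_two, show r ^ k * (genBinom (-b) k * ((k : ℝ) + q) ^ 2) =
          r ^ k * (genBinom (-b) k * (k + q)) * (k + q) by ring, norm_mul _ ((k : ℝ) + q),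
        Real.norm_of_nonneg (show (0 : ℝ) ≤ k + q by positivity)]
      ring
    simp only [hn]
    exact (FF_summable b 2 0 r 0 q hr le_rfl hq).norm.mul_left _

lemma core (q β : ℝ) (hq : 0 < q) (hβ : 0 < β) :
    IntegrableOn (fun t : ℝ => t ^ (-(1 / 2 : ℝ)) *
      ∑' k : ℕ, genBinom (-(2 * q)) k * phi 1 0 (β / t) (k + q)) (Set.Ioi 0) ∧
    ∫ t in Set.Ioi (0 : ℝ), t ^ (-(1 / 2 : ℝ)) *
      ∑' k : ℕ, genBinom (-(2 * q)) k * phi 1 0 (β / t) (k + q) =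
      √(π * β) * q * 2 ^ (-(2 * q)) := by
  set r : ℕ → ℝ := fun n => 1 - 1 / ((n : ℝ) + 1) with hrdef
  have hr : ∀ n, r n ∈ Set.Ico (0 : ℝ) 1 := by
    intro n
    have h1 : 0 < 1 / ((n : ℝ) + 1) := by positivity
    have h2 : 1 / ((n : ℝ) + 1) ≤ 1 := by
      rw [div_le_one (by positivity)]
      linarith [(Nat.cast_nonneg n : (0 : ℝ) ≤ n)]
    exact ⟨by simp only [hrdef]; linarith, by simp only [hrdef]; linarith⟩
  have hr1 : Filter.Tendsto r Filter.atTop (nhds 1) := by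
    have := (tendsto_one_div_add_atTop_nhds_zero_nat (𝕜 := ℝ)).const_sub 1
    rwa [sub_zero] at this
  have hrp : Filter.Tendsto (fun n => (1 + r n) ^ (-(2 * q))) Filter.atTop
      (nhds (2 ^ (-(2 * q)))) := by
    have := (hr1.const_add 1).rpow_const (p := -(2 * q)) (Or.inl (by norm_num))
    norm_num at this ⊢
    exact this
  have hrd : Filter.Tendsto (fun n => (1 + r n)) Filter.atTop (nhds (1 + 1)) := hr1.const_add 1
  have lim1 : Filter.Tendsto (fun n => FF (2 * q) 1 0 (r n) 0 q) Filter.atTop (nhds 0) := by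
    simp only [fun n => FF1_zero q (r n) (hr n)]
    have h := ((hr1.const_mul (2 * q)).div hrd (by norm_num)).const_sub q
    have h' := h.mul hrp
    convert h' using 1
    congr 1
    ring
  have lim2 : Filter.Tendsto (fun n => FF (2 * q) 2 0 (r n) 0 q) Filter.atTop
      (nhds (-(q / 2) * 2 ^ (-(2 * q)))) := by
    simp only [fun n => FF2_zero q (r n) (hr n)]
    have h := (hr1.const_mul (2 * q)).div hrd (by norm_num)
    have h0 := hr1.div hrd (by norm_num)
    have h' := ((((h0.neg).mul ((h.const_mul (2 * q + 1)).const_sub (2 * q))).sub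
      (h.const_mul (2 * q))).add_const (q ^ 2)).mul hrp
    convert h' using 1
    congr 1
    ring
  have limS : ∀ t ∈ Set.Ioi (0 : ℝ), Filter.Tendsto
      (fun n => t ^ (-(1 / 2 : ℝ)) * (FF (2 * q) 1 0 (r n) 0 q - FF (2 * q) 1 0 (r n) (β / t) q))
      Filter.atTop (nhds (-(t ^ (-(1 / 2 : ℝ)) *
        ∑' k : ℕ, genBinom (-(2 * q)) k * phi 1 0 (β / t) (k + q)))) := by
    intro t ht
    have ht : 0 < t := ht
    have hT : Filter.Tendsto (fun n => FF (2 * q) 1 0 (r n) (β / t) q) Filter.atTop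
        (nhds (∑' k : ℕ, genBinom (-(2 * q)) k * phi 1 0 (β / t) (k + q))) := by
      refine tendsto_tsum_of_dominated_convergence
        (gauss_summable (2 * q) q (β / t) hq (by positivity)) (fun k => ?_)
        (Filter.Eventually.of_forall fun n k => ?_)
      · simpa using (hr1.pow k).mul_const (genBinom (-(2 * q)) k * phi 1 0 (β / t) (k + q))
      · rw [Real.norm_eq_abs, abs_mul, abs_of_nonneg (pow_nonneg (hr n).1 k)]
        exact mul_le_of_le_one_left (abs_nonneg _) (pow_le_one₀ (hr n).1 (hr n).2.le)
    have := (lim1.sub hT).const_mul (t ^ (-(1 / 2 : ℝ)))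
    simpa using this
  have limS' := (ae_restrict_iff' (μ := (volume : Measure ℝ)) measurableSet_Ioi).2
    (Filter.Eventually.of_forall limS)
  have hmeas : ∀ n, AEStronglyMeasurable (fun t : ℝ => t ^ (-(1 / 2 : ℝ)) *
      (FF (2 * q) 1 0 (r n) 0 q - FF (2 * q) 1 0 (r n) (β / t) q))
      (volume.restrict (Set.Ioi 0)) := by
    intro n
    refine ContinuousOn.aestronglyMeasurable ?_ measurableSet_Ioi
    refine ContinuousOn.mul ?_ (continuousOn_const.sub ?_)
    · exact fun t ht => (Real.continuousAt_rpow_const t _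
        (Or.inl (ne_of_gt ht))).continuousWithinAt
    · refine (FF_cont_mu (2 * q) 1 (r n) q (hr n) hq).comp (f := fun t : ℝ => β / t)
        (continuousOn_const.div continuousOn_id fun t ht => ne_of_gt ht) fun t ht => ?_
      have ht : 0 < t := ht
      exact (div_pos hβ ht).le
  obtain ⟨K, hK, H⟩ := FF_diff (2 * q) q hq
  have hbint := (J_integrable β hβ).const_mul K
  have hbd : ∀ n, ∀ t ∈ Set.Ioi (0 : ℝ), ‖t ^ (-(1 / 2 : ℝ)) *
      (FF (2 * q) 1 0 (r n) 0 q - FF (2 * q) 1 0 (r n) (β / t) q)‖ ≤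
      K * (t ^ (-(1 / 2 : ℝ)) * (1 - Real.exp (-(β / t)))) := by
    intro n t ht
    have ht : 0 < t := ht
    have := H (r n) (hr n) (β / t) (by positivity)
    have e3 : 0 ≤ t ^ (-(1 / 2 : ℝ)) := by positivity
    rw [norm_mul, Real.norm_of_nonneg e3, Real.norm_eq_abs]
    have := mul_le_mul_of_nonneg_left this e3
    linarith
  have hlimm := aestronglyMeasurable_of_tendsto_ae Filter.atTop hmeas limS'
  have hlimint : IntegrableOn (fun t : ℝ => -(t ^ (-(1 / 2 : ℝ)) *
      ∑' k : ℕ, genBinom (-(2 * q)) k * phi 1 0 (β / t) (k + q))) (Set.Ioi 0) := by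
    refine Integrable.mono' hbint hlimm ?_
    refine (ae_restrict_iff' measurableSet_Ioi).2 (Filter.Eventually.of_forall fun t ht => ?_)
    exact le_of_tendsto (limS t ht).norm (Filter.Eventually.of_forall fun n => hbd n t ht)
  have hI := tendsto_integral_filter_of_dominated_convergence
    (fun t => K * (t ^ (-(1 / 2 : ℝ)) * (1 - Real.exp (-(β / t)))))
    (Filter.Eventually.of_forall hmeas)
    (Filter.Eventually.of_forall fun n => (ae_restrict_iff' measurableSet_Ioi).2
      (Filter.Eventually.of_forall (hbd n))) hbint limS'
  simp only [fun n => D_integral (2 * q) q β (r n) hq hβ (hr n), integral_neg] at hI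
  have hu := tendsto_nhds_unique hI (lim2.const_mul (2 * √(π * β)))
  refine ⟨by simpa using hlimint.neg, ?_⟩
  linear_combination -hu

/-- For `0 < q < 1` and `x > 0`, the mean first-passage time
`∫_0^∞ t f_{q,x}(t) dt` converges and equals `2qx²`. -/
theorem mean_first_passage_time (q x : ℝ) (hq0 : 0 < q) (hq1 : q < 1) (hx : 0 < x) :
    IntegrableOn (fun t : ℝ => t * fpDensity q x t) (Set.Ioi 0) ∧
    ∫ t in Set.Ioi (0 : ℝ), t * fpDensity q x t = 2 * q * x ^ 2 := by
  obtain ⟨h1, h2⟩ := core q (2 * x ^ 2) hq0 (by positivity)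
  set A : ℝ := (2 : ℝ) ^ (2 * q) * Real.sqrt 2 * x * Real.pi ^ (-(1 / 2 : ℝ)) with hA
  have hcongr : ∀ t ∈ Set.Ioi (0 : ℝ), A * (t ^ (-(1 / 2 : ℝ)) *
      ∑' k : ℕ, genBinom (-(2 * q)) k * phi 1 0 (2 * x ^ 2 / t) (k + q)) =
      t * fpDensity q x t := by
    intro t ht
    have ht : 0 < t := ht
    unfold fpDensity
    have e : t ^ (-(1 / 2 : ℝ)) = t * t ^ (-(3 / 2 : ℝ)) := by
      rw [mul_comm, ← Real.rpow_add_one ht.ne']; norm_num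
    have e2 : (∑' k : ℕ, genBinom (-(2 * q)) k * phi 1 0 (2 * x ^ 2 / t) (k + q)) =
        ∑' k : ℕ, genBinom (-(2 * q)) k * (k + q) *
          Real.exp (-(2 * x ^ 2 * (k + q) ^ 2 / t)) := by
      refine tsum_congr fun k => ?_
      rw [phi_one, show 2 * x ^ 2 / t * ((k : ℝ) + q) ^ 2 = 2 * x ^ 2 * (k + q) ^ 2 / t by ring]
      ring
    rw [e, e2, hA]
    ring
  refine ⟨IntegrableOn.congr_fun (h1.const_mul A) hcongr measurableSet_Ioi, ?_⟩
  rw [← setIntegral_congr_fun measurableSet_Ioi hcongr, integral_const_mul, h2, hA]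
  have p1 : (2 : ℝ) ^ (2 * q) * 2 ^ (-(2 * q)) = 1 := by
    rw [← Real.rpow_add (by norm_num)]; simp
  have p2 : √(π * (2 * x ^ 2)) = √π * (√2 * x) := by
    rw [Real.sqrt_mul Real.pi_pos.le, Real.sqrt_mul (by norm_num), Real.sqrt_sq hx.le]
  have p3 : Real.pi ^ (-(1 / 2 : ℝ)) * √π = 1 := by
    rw [Real.sqrt_eq_rpow, ← Real.rpow_add Real.pi_pos]; simp
  have p4 : √2 * √2 = (2 : ℝ) := Real.mul_self_sqrt (by norm_num)
  rw [p2]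
  calc _ = ((2 : ℝ) ^ (2 * q) * 2 ^ (-(2 * q))) * (Real.pi ^ (-(1 / 2 : ℝ)) * √π) *
        (√2 * √2) * q * x ^ 2 := by ring
    _ = _ := by rw [p1, p3, p4]; ring
end

section
/- For every real q with 0 < q < 1, the integral ∫_0^∞ Φ_q(μ) dμ converges and equals N(q) = 2^{2q - 3/2} Γ(1+q)² / (√π · q · Γ(1+2q)), where Φ_q(μ) = (2^{2q+1/2}/√π) μ ∑_{k=0}^∞ C(-2q, k)(k+q) e^{-2μ²(k+q)²}. -/
open scoped Real
open MeasureTheory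

/-- The scaling function
`Φ_q(μ) = (2^{2q+1/2}/√π) μ ∑_{k≥0} C(-2q,k)(k+q) e^{-2μ²(k+q)²}`. -/
noncomputable def scalingPhi (q μ : ℝ) : ℝ :=
  ((2 : ℝ) ^ (2 * q + 1 / 2) / Real.sqrt Real.pi) * μ *
    ∑' k : ℕ, genBinom (-(2 * q)) k * (k + q) * Real.exp (-(2 * μ ^ 2 * (k + q) ^ 2))

noncomputable def xb (p : ℝ) (k : ℕ) : ℝ := (-1) ^ k * genBinom (-p) k
noncomputable def xA (p : ℝ) (n : ℕ) : ℝ := ∑ k ∈ Finset.range n, genBinom (-p) k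

lemma genBinom_succ (a : ℝ) (k : ℕ) : genBinom a (k + 1) = genBinom a k * ((a - k) / (k + 1)) := by
  unfold genBinom
  rw [Finset.prod_range_succ, Nat.factorial_succ]
  push_cast
  have : (k.factorial : ℝ) ≠ 0 := by positivity
  field_simp

lemma xb_zero (p : ℝ) : xb p 0 = 1 := by simp [xb, genBinom]

lemma xb_succ (p : ℝ) (k : ℕ) : xb p (k + 1) = xb p k * ((p + k) / (k + 1)) := by
  unfold xb
  rw [genBinom_succ, pow_succ]
  ring

lemma gen_eq (p : ℝ) (k : ℕ) : genBinom (-p) k = (-1) ^ k * xb p k := by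
  unfold xb
  rw [← mul_assoc, ← pow_add, ← two_mul]
  simp

lemma xb_pos {p : ℝ} (hp : 0 < p) (k : ℕ) : 0 < xb p k := by
  induction k with
  | zero => simp [xb_zero]
  | succ k ih => rw [xb_succ]; positivity

lemma xb_le {p : ℝ} (hp : 0 < p) (hp2 : p < 2) (k : ℕ) : xb p k ≤ k + 1 := by
  induction k with
  | zero => simp [xb_zero]
  | succ k ih =>
    rw [xb_succ]
    have h1 : (p + k) / (k + 1) ≤ ((2 : ℝ) + k) / (k + 1) := by gcongr
    calc _ ≤ ((k : ℝ) + 1) * ((2 + k) / (k + 1)) :=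
          mul_le_mul ih h1 (by positivity) (by positivity)
      _ = _ := by push_cast; field_simp; ring

lemma abs_gen {p : ℝ} (hp : 0 < p) (k : ℕ) : |genBinom (-p) k| = xb p k := by
  rw [gen_eq, abs_mul, abs_pow]
  simp [abs_of_pos (xb_pos hp k)]

lemma xA_succ (p : ℝ) (n : ℕ) : xA p (n + 1) = xA p n + genBinom (-p) n := by
  simp [xA, Finset.sum_range_succ]

lemma xA_bound {p : ℝ} (hp : 0 < p) (n : ℕ) : |xA p (n + 1)| ≤ 1 + xb p n := by
  have key : ∀ c : ℕ → ℝ, c 0 = 1 → (∀ n, c (n + 1) = xb p (n + 1) - c n) →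
      ∀ n, |c n| ≤ 1 + xb p n := by
    intro c h0 hs n
    rcases le_total 1 p with h | h
    · have mono : ∀ n, xb p n ≤ xb p (n + 1) := by
        intro n
        rw [xb_succ]
        apply le_mul_of_one_le_right (xb_pos hp n).le
        rw [le_div_iff₀ (by positivity)]; linarith
      have : 0 ≤ c n ∧ c n ≤ xb p n := by
        induction n with
        | zero => simp [h0, xb_zero]
        | succ n ih =>
          rw [hs]
          have := mono n
          constructor <;> linarith [ih.1, ih.2]
      rw [abs_of_nonneg this.1]; linarith
    · have mono : ∀ n, xb p (n + 1) ≤ xb p n := by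
        intro n
        rw [xb_succ]
        apply mul_le_of_le_one_right (xb_pos hp n).le
        rw [div_le_iff₀ (by positivity)]; linarith
      have : |2 * c n - xb p n| ≤ 2 - xb p n := by
        induction n with
        | zero => simp [h0, xb_zero]; norm_num
        | succ n ih =>
          rw [hs]
          have := mono n
          rw [abs_le] at ih ⊢
          constructor <;> linarith [ih.1, ih.2]
      have hb := xb_pos hp n
      rw [abs_le] at this ⊢
      constructor <;> linarith [this.1, this.2]
  have := key (fun n => (-1) ^ n * xA p (n + 1)) (by simp [xA, genBinom]) (by
    intro n
    rw [xA_succ p (n + 1), xb, pow_succ]; ring) n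
  simpa [abs_mul] using this

lemma xA_le {p : ℝ} (hp : 0 < p) (hp2 : p < 2) (n : ℕ) : |xA p n| ≤ n + 2 := by
  cases n with
  | zero => simp [xA]
  | succ n =>
    have := xA_bound hp n
    have := xb_le hp hp2 n
    push_cast
    linarith

lemma summable_xA {p : ℝ} (hp : 0 < p) (hp2 : p < 2) :
    Summable (fun k : ℕ => |xA p (k + 1)| * (1 / (((k : ℝ) + 1) * (k + 2)))) := by
  have tel : ∀ P : ℝ, 0 < P → P < 2 →
      Summable (fun k : ℕ => xb P k * (1 / (((k : ℝ) + 1) * (k + 2)))) := by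
    intro P hP hP2
    refine summable_of_sum_range_le (c := 1 / (2 - P)) ?_ ?_
    · intro k; have := xb_pos hP k; positivity
    · intro n
      have : ∑ k ∈ Finset.range n, xb P k * (1 / (((k : ℝ) + 1) * (k + 2)))
          = (1 - xb P n / (n + 1)) / (2 - P) := by
        have h2 : 2 - P ≠ 0 := by linarith
        induction n with
        | zero => simp [xb_zero]
        | succ n ih =>
          rw [Finset.sum_range_succ, ih, xb_succ]
          push_cast
          field_simp
          ring
      rw [this]
      have hb := xb_pos hP n
      have : 0 ≤ xb P n / (n + 1) := by positivity
      apply div_le_div_of_nonneg_right _ (by linarith)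
      linarith
  have h1 : ∀ k, xb 1 k = 1 := by
    intro k
    induction k with
    | zero => exact xb_zero 1
    | succ k ih => rw [xb_succ, ih, one_mul, add_comm]; exact div_self (by positivity)
  refine Summable.of_nonneg_of_le (fun k => by positivity) ?_
    ((tel 1 one_pos one_lt_two).add (tel p hp hp2))
  intro k
  rw [h1, ← add_mul]
  exact mul_le_mul_of_nonneg_right (xA_bound hp k) (by positivity)

lemma abel_fin (p : ℝ) (u : ℕ → ℝ) (n : ℕ) :
    ∑ k ∈ Finset.range n, xA p (k + 1) * (u k - u (k + 1)) =
      ∑ k ∈ Finset.range n, genBinom (-p) k * u k - xA p n * u n := by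
  induction n with
  | zero => simp [xA]
  | succ n ih => rw [Finset.sum_range_succ, Finset.sum_range_succ, ih, xA_succ]; ring

lemma abel {p : ℝ} (hp : 0 < p) (hp2 : p < 2) (u : ℕ → ℝ) (C r : ℝ) (hr0 : 0 ≤ r) (hr : r < 1)
    (hu : ∀ k, |u k| ≤ C * (k + 1) * r ^ k) :
    Summable (fun k => genBinom (-p) k * u k) ∧
    ∑' k, xA p (k + 1) * (u k - u (k + 1)) = ∑' k, genBinom (-p) k * u k := by
  have hC : 0 ≤ C := by have := (abs_nonneg _).trans (hu 0); simpa using this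
  have hr' : ‖r‖ < 1 := by rwa [Real.norm_of_nonneg hr0]
  have hmaj : Summable (fun k : ℕ => C * (((k : ℝ) ^ 2 * r ^ k) + 5 * ((k : ℝ) ^ 1 * r ^ k)
      + 6 * ((k : ℝ) ^ 0 * r ^ k))) :=
    (((summable_pow_mul_geometric_of_norm_lt_one 2 hr').add
      ((summable_pow_mul_geometric_of_norm_lt_one 1 hr').mul_left 5)).add
      ((summable_pow_mul_geometric_of_norm_lt_one 0 hr').mul_left 6)).mul_left C
  have bd : ∀ (x : ℕ → ℝ) (v : ℕ → ℝ), (∀ k, |x k| ≤ k + 3) → (∀ k, |v k| ≤ C * (k + 2) * r ^ k) →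
      Summable (fun k => x k * v k) := by
    intro x v hx hv
    refine Summable.of_norm_bounded hmaj ?_
    intro k
    rw [Real.norm_eq_abs, abs_mul]
    calc _ ≤ ((k : ℝ) + 3) * (C * (k + 2) * r ^ k) :=
          mul_le_mul (hx k) (hv k) (abs_nonneg _) (by positivity)
      _ = _ := by ring
  have hu2 : ∀ k, |u k| ≤ C * (k + 2) * r ^ k := fun k => (hu k).trans (by gcongr; norm_num)
  have hu3 : ∀ k, |u (k + 1)| ≤ C * (k + 2) * r ^ k := fun k => (hu (k + 1)).trans (by
    push_cast
    have : r ^ (k + 1) ≤ r ^ k := pow_le_pow_of_le_one hr0 hr.le (by omega)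
    have e : (k : ℝ) + 1 + 1 = k + 2 := by ring
    rw [e]
    gcongr)
  have s1 : Summable (fun k => genBinom (-p) k * u k) :=
    bd _ _ (fun k => by rw [abs_gen hp]; linarith [xb_le hp hp2 k]) hu2
  have hA : ∀ k, |xA p (k + 1)| ≤ k + 3 := fun k => by
    have := xA_le hp hp2 (k + 1); push_cast at this; linarith
  have s2 : Summable (fun k => xA p (k + 1) * (u k - u (k + 1))) := by
    simpa only [mul_sub] using (bd _ _ hA hu2).sub (bd _ _ hA hu3)
  have s3 : Summable (fun k => xA p k * u k) :=
    bd _ _ (fun k => by linarith [xA_le hp hp2 k]) hu2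
  refine ⟨s1, ?_⟩
  refine tendsto_nhds_unique s2.hasSum.tendsto_sum_nat ?_
  simp_rw [abel_fin]
  simpa using s1.hasSum.tendsto_sum_nat.sub s3.tendsto_atTop_zero

lemma binom_tsum (p x : ℝ) (hx0 : 0 < x) (hx1 : x < 1) :
    ∑' k, genBinom (-p) k * x ^ k = (1 + x) ^ (-p) := by
  have h := (Real.one_add_rpow_hasFPowerSeriesOnBall_zero (a := -p)).hasSum (y := x) (by
    simp [← ofReal_norm, abs_of_pos hx0, hx1])
  have e : ∀ k, Ring.choose (-p) k = genBinom (-p) k := by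
    intro k
    have e2 : (descPochhammer ℤ k).smeval (-p) = ∏ i ∈ Finset.range k, (-p - i) := by
      induction k with
      | zero => simp
      | succ k ih =>
        rw [Finset.prod_range_succ, ← ih]
        simp [descPochhammer_succ_right, Polynomial.smeval_mul, Polynomial.smeval_natCast]
    rw [Ring.choose_eq_smul, genBinom, e2]
    rw [smul_eq_mul, div_eq_inv_mul]
  rw [zero_add] at h
  rw [← h.tsum_eq]
  congr 1; ext k
  rw [binomialSeries_apply, e]
  simp


lemma gauss_int {x : ℝ} (hx : 0 < x) :
    IntegrableOn (fun μ : ℝ => μ * Real.exp (-(2 * μ ^ 2 * x ^ 2))) (Set.Ioi 0) ∧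
    ∫ μ in Set.Ioi (0 : ℝ), μ * Real.exp (-(2 * μ ^ 2 * x ^ 2)) = 1 / (4 * x ^ 2) := by
  have hb : 0 < 2 * x ^ 2 := by positivity
  have h := integrable_mul_exp_neg_mul_sq hb
  have e : (fun μ : ℝ => μ * Real.exp (-(2 * μ ^ 2 * x ^ 2))) =
      fun μ : ℝ => μ * Real.exp (-(2 * x ^ 2) * μ ^ 2) := by
    ext μ; congr 2; ring
  refine ⟨by rw [e]; exact h.integrableOn, ?_⟩
  rw [e]
  have h2 := integral_rpow_mul_exp_neg_mul_rpow (p := 2) (q := 1) two_pos (by norm_num) hb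
  simp only [Real.rpow_one, Real.rpow_two] at h2
  rw [h2]
  norm_num
  rw [Real.rpow_neg_one]
  field_simp
  norm_num

noncomputable def xG (x μ : ℝ) : ℝ := μ * x * Real.exp (-(2 * μ ^ 2 * x ^ 2))

lemma xG_int {x : ℝ} (hx : 0 < x) :
    IntegrableOn (xG x) (Set.Ioi 0) ∧ ∫ μ in Set.Ioi (0 : ℝ), xG x μ = 1 / (4 * x) := by
  have e : xG x = fun μ => x * (μ * Real.exp (-(2 * μ ^ 2 * x ^ 2))) := by
    ext μ; unfold xG; ring
  obtain ⟨h1, h2⟩ := gauss_int hx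
  rw [e]
  refine ⟨h1.const_mul x, ?_⟩
  rw [integral_const_mul, h2]
  field_simp

lemma xG_abs {x : ℝ} (hx : 0 < x) :
    ∫ μ in Set.Ioi (0 : ℝ), |xG x μ - xG (x + 1) μ| ≤ 3 / 4 * (1 / (x * (x + 1))) := by
  have hy : 0 < x + 1 := by positivity
  obtain ⟨h1, h2⟩ := gauss_int hx
  obtain ⟨h3, h4⟩ := gauss_int hy
  have hi : IntegrableOn (fun μ : ℝ => x * (μ * Real.exp (-(2 * μ ^ 2 * x ^ 2))
      - μ * Real.exp (-(2 * μ ^ 2 * (x + 1) ^ 2))) + μ * Real.exp (-(2 * μ ^ 2 * (x + 1) ^ 2)))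
      (Set.Ioi 0) := ((h1.sub h3).const_mul x).add h3
  calc _ ≤ ∫ μ in Set.Ioi (0 : ℝ), (x * (μ * Real.exp (-(2 * μ ^ 2 * x ^ 2))
      - μ * Real.exp (-(2 * μ ^ 2 * (x + 1) ^ 2))) + μ * Real.exp (-(2 * μ ^ 2 * (x + 1) ^ 2))) := by
        refine setIntegral_mono_on (((xG_int hx).1.sub (xG_int hy).1).abs) hi measurableSet_Ioi ?_
        intro μ hμ
        have hμ : 0 < μ := hμ
        have hle : Real.exp (-(2 * μ ^ 2 * (x + 1) ^ 2)) ≤ Real.exp (-(2 * μ ^ 2 * x ^ 2)) := by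
          apply Real.exp_le_exp.2
          have : 0 < μ ^ 2 * x := by positivity
          nlinarith [sq_nonneg μ]
        have e1 : xG x μ - xG (x + 1) μ = x * (μ * Real.exp (-(2 * μ ^ 2 * x ^ 2))
            - μ * Real.exp (-(2 * μ ^ 2 * (x + 1) ^ 2)))
            - μ * Real.exp (-(2 * μ ^ 2 * (x + 1) ^ 2)) := by unfold xG; ring
        have p1 : 0 ≤ x * (μ * Real.exp (-(2 * μ ^ 2 * x ^ 2))
            - μ * Real.exp (-(2 * μ ^ 2 * (x + 1) ^ 2))) :=
          mul_nonneg hx.le (sub_nonneg.2 (mul_le_mul_of_nonneg_left hle hμ.le))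
        have p2 : 0 ≤ μ * Real.exp (-(2 * μ ^ 2 * (x + 1) ^ 2)) := by positivity
        rw [e1, abs_le]
        constructor <;> linarith
    _ = x * (1 / (4 * x ^ 2) - 1 / (4 * (x + 1) ^ 2)) + 1 / (4 * (x + 1) ^ 2) := by
        have h13 : IntegrableOn (fun μ : ℝ => x * (μ * Real.exp (-(2 * μ ^ 2 * x ^ 2))
          - μ * Real.exp (-(2 * μ ^ 2 * (x + 1) ^ 2)))) (Set.Ioi 0) := (h1.sub h3).const_mul x
        rw [integral_add h13 h3, integral_const_mul, integral_sub h1 h3,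
          h2, h4]
    _ ≤ _ := by
        have : 3 / 4 * (1 / (x * (x + 1))) - (x * (1 / (4 * x ^ 2) - 1 / (4 * (x + 1) ^ 2))
          + 1 / (4 * (x + 1) ^ 2)) = 1 / (4 * x * (x + 1) ^ 2) * 2 := by
          field_simp; ring
        have : 0 < 1 / (4 * x * (x + 1) ^ 2) * 2 := by positivity
        linarith

lemma frac_le {q : ℝ} (hq0 : 0 < q) (hq1 : q < 1) (k : ℕ) :
    1 / (((k : ℝ) + q) * (k + q + 1)) ≤ (1 / q) * (1 / (((k : ℝ) + 1) * (k + 2))) * 2 := by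
  have hk : (0 : ℝ) ≤ k := by positivity
  rw [div_mul_div_comm, div_mul_eq_mul_div, div_le_div_iff₀ (by positivity) (by positivity)]
  have : q * ((k : ℝ) + 1) ≤ k + q := by nlinarith
  have : (k : ℝ) + 2 ≤ (k + q + 1) * 2 := by nlinarith
  have : q * ((k : ℝ) + 1) * (k + 2) ≤ (k + q) * ((k + q + 1) * 2) := by gcongr
  nlinarith

lemma sum1 {q : ℝ} (hq0 : 0 < q) (hq1 : q < 1) :
    HasSum (fun k : ℕ => xA (2 * q) (k + 1) * (1 / (4 * (k + q)) - 1 / (4 * (k + q + 1))))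
      (∫ μ in Set.Ioi (0 : ℝ), ∑' k : ℕ, genBinom (-(2 * q)) k * xG (k + q) μ) := by
  have hi : ∀ k : ℕ, Integrable (fun μ => xA (2 * q) (k + 1) * (xG (k + q) μ - xG (k + q + 1) μ))
      (volume.restrict (Set.Ioi 0)) := fun k =>
    ((xG_int (by positivity)).1.sub (xG_int (by positivity)).1).const_mul _
  have h := hasSum_integral_of_summable_integral_norm hi (by
    refine Summable.of_nonneg_of_le (fun k => integral_nonneg fun _ => norm_nonneg _) ?_
      ((summable_xA (p := 2 * q) (by linarith) (by linarith)).mul_left (3 / 4 * (1 / q) * 2))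
    intro k
    simp_rw [Real.norm_eq_abs, abs_mul]
    rw [integral_const_mul]
    calc _ ≤ |xA (2 * q) (k + 1)| * (3 / 4 * ((1 / q) * (1 / (((k : ℝ) + 1) * (k + 2))) * 2)) := by
          refine mul_le_mul_of_nonneg_left ?_ (abs_nonneg _)
          exact (xG_abs (by positivity)).trans
            (mul_le_mul_of_nonneg_left (frac_le hq0 hq1 k) (by norm_num))
      _ = _ := by ring)
  have e : ∀ k : ℕ, ∫ μ in Set.Ioi (0 : ℝ),
      xA (2 * q) (k + 1) * (xG (k + q) μ - xG (k + q + 1) μ) =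
      xA (2 * q) (k + 1) * (1 / (4 * (k + q)) - 1 / (4 * (k + q + 1))) := by
    intro k
    rw [integral_const_mul, integral_sub (xG_int (by positivity)).1 (xG_int (by positivity)).1,
      (xG_int (by positivity)).2, (xG_int (by positivity)).2]
  simp_rw [e] at h
  suffices heq : ∫ μ in Set.Ioi (0 : ℝ), ∑' k : ℕ, genBinom (-(2 * q)) k * xG (k + q) μ =
      ∫ μ in Set.Ioi (0 : ℝ), ∑' k : ℕ,
        xA (2 * q) (k + 1) * (xG (k + q) μ - xG (k + q + 1) μ) by
    rw [heq]; exact h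
  refine setIntegral_congr_fun measurableSet_Ioi ?_
  intro μ hμ
  have hμ : 0 < μ := hμ
  have := (abel (p := 2 * q) (by linarith) (by linarith) (fun k => xG (k + q) μ) μ
    (Real.exp (-(2 * μ ^ 2))) (Real.exp_pos _).le
    (by rw [Real.exp_lt_one_iff]; have : 0 < μ ^ 2 := by positivity
        linarith) (by
      intro k
      have hx : 0 ≤ xG (k + q) μ := by unfold xG; positivity
      rw [abs_of_nonneg hx, ← Real.exp_nat_mul]
      unfold xG
      have hk : (k : ℝ) ≤ k ^ 2 := by
        exact_mod_cast Nat.le_self_pow two_ne_zero k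
      have h2 : (k : ℝ) ≤ (k + q) ^ 2 := by
        have : (0 : ℝ) ≤ k * q := by positivity
        nlinarith [sq_nonneg q]
      have h3 : (k : ℝ) + q ≤ k + 1 := by linarith
      have h4 : -(2 * μ ^ 2 * (k + q) ^ 2) ≤ (k : ℝ) * -(2 * μ ^ 2) := by
        have := mul_le_mul_of_nonneg_left h2 (by positivity : 0 ≤ 2 * μ ^ 2)
        linarith
      gcongr)).2
  simp only at this ⊢
  rw [← this]
  congr 1; ext k
  push_cast
  rw [add_right_comm]

lemma rp_int {s : ℝ} (hs : 0 < s) :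
    IntegrableOn (fun x : ℝ => x ^ (s - 1)) (Set.Ioo 0 1) ∧
    ∫ x in Set.Ioo (0 : ℝ) 1, x ^ (s - 1) = 1 / s := by
  constructor
  · have := intervalIntegral.intervalIntegrable_rpow' (a := 0) (b := 1) (r := s - 1) (by linarith)
    rw [intervalIntegrable_iff_integrableOn_Ioo_of_le zero_le_one] at this
    exact this
  · rw [← integral_Ioc_eq_integral_Ioo, ← intervalIntegral.integral_of_le zero_le_one,
      integral_rpow (Or.inl (by linarith))]
    simp [Real.zero_rpow hs.ne']

lemma sum2 {q : ℝ} (hq0 : 0 < q) (hq1 : q < 1) :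
    HasSum (fun k : ℕ => xA (2 * q) (k + 1) * (1 / (k + q) - 1 / (k + q + 1)))
      (∫ x in Set.Ioo (0 : ℝ) 1, x ^ (q - 1) * (1 + x) ^ (-(2 * q))) := by
  have r1 := fun k : ℕ => rp_int (s := k + q) (by positivity)
  have r2 := fun k : ℕ => rp_int (s := k + q + 1) (by positivity)
  have hi : ∀ k : ℕ, Integrable (fun x : ℝ => xA (2 * q) (k + 1) *
      (x ^ ((k : ℝ) + q - 1) - x ^ ((k : ℝ) + q + 1 - 1)))
      (volume.restrict (Set.Ioo 0 1)) := fun k => ((r1 k).1.sub (r2 k).1).const_mul _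
  have e0 : ∀ k : ℕ, ∫ x in Set.Ioo (0 : ℝ) 1, (x ^ ((k : ℝ) + q - 1) - x ^ ((k : ℝ) + q + 1 - 1))
      = 1 / (k + q) - 1 / (k + q + 1) := by
    intro k
    rw [integral_sub (r1 k).1 (r2 k).1, (r1 k).2, (r2 k).2]
  have h := hasSum_integral_of_summable_integral_norm hi (by
    refine Summable.of_nonneg_of_le (fun k => integral_nonneg fun _ => norm_nonneg _) ?_
      ((summable_xA (p := 2 * q) (by linarith) (by linarith)).mul_left ((1 / q) * 2))
    intro k
    simp_rw [Real.norm_eq_abs, abs_mul]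
    rw [integral_const_mul]
    have e1 : ∫ x in Set.Ioo (0 : ℝ) 1, |x ^ ((k : ℝ) + q - 1) - x ^ ((k : ℝ) + q + 1 - 1)|
      = 1 / (k + q) - 1 / (k + q + 1) := by
      rw [← e0]
      refine setIntegral_congr_fun measurableSet_Ioo ?_
      intro x hx
      refine abs_of_nonneg (sub_nonneg.2 ?_)
      exact Real.rpow_le_rpow_of_exponent_ge hx.1 hx.2.le (by linarith)
    rw [e1]
    calc _ ≤ |xA (2 * q) (k + 1)| * ((1 / q) * (1 / (((k : ℝ) + 1) * (k + 2))) * 2) := by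
          refine mul_le_mul_of_nonneg_left ?_ (abs_nonneg _)
          refine le_trans (le_of_eq ?_) (frac_le hq0 hq1 k)
          have : (k : ℝ) + q ≠ 0 := by positivity
          field_simp
          ring
      _ = _ := by ring)
  simp_rw [integral_const_mul, e0] at h
  suffices heq : ∫ x in Set.Ioo (0 : ℝ) 1, x ^ (q - 1) * (1 + x) ^ (-(2 * q)) =
      ∫ x in Set.Ioo (0 : ℝ) 1, ∑' k : ℕ,
        xA (2 * q) (k + 1) * (x ^ ((k : ℝ) + q - 1) - x ^ ((k : ℝ) + q + 1 - 1)) by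
    rw [heq]; exact h
  refine setIntegral_congr_fun measurableSet_Ioo ?_
  intro x hx
  have := (abel (p := 2 * q) (by linarith) (by linarith) (fun k => x ^ k) 1 x hx.1.le hx.2 (by
      intro k
      rw [abs_of_nonneg (pow_nonneg hx.1.le k), one_mul]
      apply le_mul_of_one_le_left (pow_nonneg hx.1.le k)
      have : (0 : ℝ) ≤ k := by positivity
      linarith)).2
  simp only at this ⊢
  rw [← binom_tsum _ x hx.1 hx.2, ← this, ← tsum_mul_left]
  congr 1; ext k
  have e1 : x ^ ((k : ℝ) + q - 1) = x ^ (q - 1) * x ^ k := by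
    rw [← Real.rpow_natCast, ← Real.rpow_add hx.1]; congr 1; ring
  have e2 : x ^ ((k : ℝ) + q + 1 - 1) = x ^ (q - 1) * x ^ (k + 1) := by
    rw [← Real.rpow_natCast, ← Real.rpow_add hx.1]; congr 1; push_cast; ring
  rw [e1, e2]; ring

lemma beta_int {q : ℝ} (hq0 : 0 < q) :
    ∫ x in (0 : ℝ)..1, x ^ (q - 1) * (1 - x) ^ (q - 1) = Real.Gamma q ^ 2 / Real.Gamma (2 * q) ∧
    IntervalIntegrable (fun x : ℝ => x ^ (q - 1) * (1 - x) ^ (q - 1)) volume 0 1 := by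
  have h1 := Complex.betaIntegral_eq_Gamma_mul_div (q : ℂ) q (by simpa) (by simpa)
  have h2 := Complex.betaIntegral_convergent (u := (q : ℂ)) (v := q) (by simpa) (by simpa)
  have e : Set.EqOn (fun x : ℝ => (x : ℂ) ^ ((q : ℂ) - 1) * (1 - (x : ℂ)) ^ ((q : ℂ) - 1))
      (fun x : ℝ => ((x ^ (q - 1) * (1 - x) ^ (q - 1) : ℝ) : ℂ)) (Set.uIcc 0 1) := by
    intro x hx
    rw [Set.uIcc_of_le zero_le_one] at hx
    simp only
    rw [Complex.ofReal_mul, Complex.ofReal_cpow hx.1, Complex.ofReal_cpow (by linarith [hx.2])]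
    push_cast
    rfl
  constructor
  · rw [Complex.betaIntegral, intervalIntegral.integral_congr e, intervalIntegral.integral_ofReal,
      ← Complex.ofReal_add, Complex.Gamma_ofReal, Complex.Gamma_ofReal] at h1
    rw [two_mul, sq]
    exact_mod_cast h1
  · rw [intervalIntegrable_iff] at h2 ⊢
    have h3 := h2.congr_fun (e.mono Set.uIoc_subset_uIcc) measurableSet_uIoc
    exact h3.re

lemma half_beta {q : ℝ} (hq0 : 0 < q) :
    ∫ x in Set.Ioo (0 : ℝ) 1, x ^ (q - 1) * (1 + x) ^ (-(2 * q)) =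
      Real.Gamma q ^ 2 / Real.Gamma (2 * q) / 2 := by
  obtain ⟨hb, hbi⟩ := beta_int hq0
  set f : ℝ → ℝ := fun x : ℝ => x ^ (q - 1) * (1 - x) ^ (q - 1) with hf
  have himg : (fun x : ℝ => x / (1 + x)) '' Set.Ioo 0 1 = Set.Ioo 0 (1 / 2) := by
    ext t
    constructor
    · rintro ⟨x, ⟨h0, h1⟩, rfl⟩
      refine ⟨by positivity, ?_⟩
      simp only
      rw [div_lt_div_iff₀ (by positivity) two_pos]; linarith
    · rintro ⟨h0, h1⟩
      have h2 : 0 < 1 - t := by linarith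
      refine ⟨t / (1 - t), ⟨by positivity, ?_⟩, ?_⟩
      · rw [div_lt_one h2]; linarith
      · simp only
        field_simp
        ring
  have hcv := integral_image_eq_integral_abs_deriv_smul (s := Set.Ioo (0 : ℝ) 1)
    (f := fun x : ℝ => x / (1 + x)) (f' := fun x => 1 / (1 + x) ^ 2) measurableSet_Ioo
    (by
      intro x hx
      have h1 : 1 + x ≠ 0 := by linarith [hx.1]
      have := ((hasDerivAt_id x).div ((hasDerivAt_id x).const_add 1) h1)
      refine (this.congr_deriv ?_).hasDerivWithinAt
      simp)
    (by
      intro x hx y hy hxy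
      have h1 : 1 + x ≠ 0 := by linarith [hx.1]
      have h2 : 1 + y ≠ 0 := by linarith [hy.1]
      simp only at hxy
      rw [div_eq_div_iff h1 h2] at hxy
      linarith) f
  rw [himg] at hcv
  have e1 : ∫ x in Set.Ioo (0 : ℝ) 1, x ^ (q - 1) * (1 + x) ^ (-(2 * q)) =
      ∫ x in (0 : ℝ)..(1 / 2), f x := by
    rw [intervalIntegral.integral_of_le (by norm_num), integral_Ioc_eq_integral_Ioo, hcv]
    refine setIntegral_congr_fun measurableSet_Ioo ?_
    intro x hx
    have h1 : 0 < 1 + x := by linarith [hx.1]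
    simp only [smul_eq_mul, hf]
    have e2 : 1 - x / (1 + x) = (1 + x)⁻¹ := by field_simp; ring
    rw [e2, Real.div_rpow hx.1.le h1.le, Real.inv_rpow h1.le, abs_of_pos (by positivity),
      div_eq_mul_inv (x ^ (q - 1)), ← Real.rpow_neg h1.le, one_div, ← Real.rpow_natCast, ← Real.rpow_neg h1.le]
    have e3 : (1 + x) ^ (-(2 * q)) =
        (1 + x) ^ (-((2 : ℕ) : ℝ)) * (1 + x) ^ (-(q - 1)) * (1 + x) ^ (-(q - 1)) := by
      rw [← Real.rpow_add h1, ← Real.rpow_add h1]; congr 1; push_cast; ring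
    rw [e3]; ring
  have e2 : ∫ x in (1 / 2 : ℝ)..1, f x = ∫ x in (0 : ℝ)..(1 / 2), f x := by
    have := intervalIntegral.integral_comp_sub_left (a := 0) (b := 1 / 2) f 1
    have e3 : (1 : ℝ) - 1 / 2 = 1 / 2 := by norm_num
    rw [e3, sub_zero] at this
    rw [← this]
    congr 1; ext x
    simp only [hf]
    rw [sub_sub_cancel, mul_comm]
  have i1 : IntervalIntegrable f volume 0 (1 / 2) := hbi.mono_set (by
    rw [Set.uIcc_of_le (by norm_num), Set.uIcc_of_le (by norm_num)]
    exact Set.Icc_subset_Icc le_rfl (by norm_num))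
  have i2 : IntervalIntegrable f volume (1 / 2) 1 := hbi.mono_set (by
    rw [Set.uIcc_of_le (by norm_num), Set.uIcc_of_le (by norm_num)]
    exact Set.Icc_subset_Icc (by norm_num) le_rfl)
  have := intervalIntegral.integral_add_adjacent_intervals i1 i2
  rw [e1]
  linarith

/-- For `0 < q < 1`, `∫_0^∞ Φ_q(μ) dμ` converges and equals
`N(q) = 2^{2q-3/2} Γ(1+q)² / (√π q Γ(1+2q))`. -/
theorem integral_scalingPhi (q : ℝ) (hq0 : 0 < q) (hq1 : q < 1) :
    IntegrableOn (scalingPhi q) (Set.Ioi 0) ∧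
    ∫ μ in Set.Ioi (0 : ℝ), scalingPhi q μ =
      (2 : ℝ) ^ (2 * q - 3 / 2) * Real.Gamma (1 + q) ^ 2 /
        (Real.sqrt Real.pi * q * Real.Gamma (1 + 2 * q)) := by
  have hG1 : 0 < Real.Gamma q := Real.Gamma_pos_of_pos hq0
  have hG2 : 0 < Real.Gamma (2 * q) := Real.Gamma_pos_of_pos (by linarith)
  have hval : ∫ μ in Set.Ioi (0 : ℝ), scalingPhi q μ =
      (2 : ℝ) ^ (2 * q - 3 / 2) * Real.Gamma (1 + q) ^ 2 /
        (Real.sqrt Real.pi * q * Real.Gamma (1 + 2 * q)) := by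
    have h1 := sum1 hq0 hq1
    have h2 := (sum2 hq0 hq1).mul_left (1 / 4)
    have h3 : (fun k : ℕ => xA (2 * q) (k + 1) * (1 / (4 * (k + q)) - 1 / (4 * (k + q + 1)))) =
      fun k : ℕ => 1 / 4 * (xA (2 * q) (k + 1) * (1 / (k + q) - 1 / (k + q + 1))) := by
      ext k
      have : (k : ℝ) + q ≠ 0 := by positivity
      field_simp
    rw [h3] at h1
    have h4 := h1.unique h2
    rw [half_beta hq0] at h4
    have h5 : scalingPhi q = fun μ => ((2 : ℝ) ^ (2 * q + 1 / 2) / Real.sqrt Real.pi) *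
        ∑' k : ℕ, genBinom (-(2 * q)) k * xG (k + q) μ := by
      ext μ
      unfold scalingPhi
      rw [mul_assoc, ← tsum_mul_left]
      congr 2; ext k
      unfold xG; ring
    rw [h5, integral_const_mul, h4, add_comm 1 q, add_comm 1 (2 * q), Real.Gamma_add_one hq0.ne',
      Real.Gamma_add_one (by positivity)]
    have h6 : (2 : ℝ) ^ (2 * q + 1 / 2) = 2 ^ (2 * q - 3 / 2) * 4 := by
      have : (4 : ℝ) = 2 ^ (2 : ℝ) := by norm_num
      rw [this, ← Real.rpow_add two_pos]; congr 1; ring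
    rw [h6]
    field_simp
    try norm_num
  refine ⟨?_, hval⟩
  apply Integrable.of_integral_ne_zero
  rw [hval]
  have : 0 < Real.Gamma (1 + q) := Real.Gamma_pos_of_pos (by linarith)
  have : 0 < Real.Gamma (1 + 2 * q) := Real.Gamma_pos_of_pos (by linarith)
  positivity
end

section
/- For every real q with 0 < q < 1, q ≠ 1/2, q ≠ 3/4, the double integral 4q(1-q) ∫_0^∞ (1/s)(1+s)^{2q-3} ( ∫_0^s r (1+r)^{1-4q} dr ) ds converges and equals 1 - 2q²/(1-2q)² - (2π q(1-q) / ((1-2q)(3-4q))) · cot(2πq). -/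
open scoped Real
open MeasureTheory

open Filter Topology in
lemma aux_sum {α : Type*} [MeasurableSpace α] {μ : Measure α} (F : ℕ → α → ℝ) (f : α → ℝ) (L : ℝ)
    (hF : ∀ n, Integrable (F n) μ) (hn : ∀ n, 0 ≤ᵐ[μ] F n)
    (hL : HasSum (fun n => ∫ x, F n x ∂μ) L)
    (hf : ∀ᵐ x ∂μ, HasSum (fun n => F n x) (f x)) :
    Integrable f μ ∧ ∫ x, f x ∂μ = L := by
  have hn' : ∀ᵐ x ∂μ, ∀ n, 0 ≤ F n x := ae_all_iff.2 hn
  have hmeas : AEStronglyMeasurable f μ := by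
    refine aestronglyMeasurable_of_tendsto_ae (u := atTop)
      (f := fun N x => ∑ n ∈ Finset.range N, F n x) (fun N => ?_) ?_
    · exact (integrable_finsetSum _ (fun n _ => hF n)).aestronglyMeasurable
    · filter_upwards [hf] with x hx using hx.tendsto_sum_nat
  have hnn : 0 ≤ᵐ[μ] f := by
    filter_upwards [hf, hn'] with x hx h using hx.nonneg h
  have hIn : ∀ n, 0 ≤ ∫ x, F n x ∂μ := fun n => integral_nonneg_of_ae (hn n)
  have key : ∫⁻ x, ENNReal.ofReal (f x) ∂μ = ENNReal.ofReal L := by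
    have h1 : ∫⁻ x, ENNReal.ofReal (f x) ∂μ = ∫⁻ x, ∑' n, ENNReal.ofReal (F n x) ∂μ := by
      refine lintegral_congr_ae ?_
      filter_upwards [hf, hn'] with x hx h
      rw [← hx.tsum_eq, ENNReal.ofReal_tsum_of_nonneg h hx.summable]
    rw [h1, lintegral_tsum (fun n => (hF n).aestronglyMeasurable.aemeasurable.ennreal_ofReal),
      ← hL.tsum_eq, ENNReal.ofReal_tsum_of_nonneg hIn hL.summable]
    congr 1
    ext n
    rw [ofReal_integral_eq_lintegral_ofReal (hF n) (hn n)]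
  refine ⟨?_, ?_⟩
  · rw [← lintegral_ofReal_ne_top_iff_integrable hmeas hnn, key]
    exact ENNReal.ofReal_ne_top
  · rw [integral_eq_lintegral_of_nonneg_ae hnn hmeas, key,
      ENNReal.toReal_ofReal (hL.nonneg hIn)]

lemma aux_alg (q d a e p K : ℝ) (h1 : d = 1 - 2 * q) (h2 : a = 3 - 4 * q) (h3 : e = 1 - q)
    (hq : q ≠ 0) (hd : d ≠ 0) (ha : a ≠ 0) (he : e ≠ 0) :
    4 * q * e * (1 / (2 * d) * (1 / (2 * q)) - 1 / (2 * d * a) * (p * K + 1 / d + 1 / (2 * e))) =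
      1 - 2 * q ^ 2 / d ^ 2 - 2 * p * q * e / (d * a) * K := by
  field_simp
  subst h1 h2 h3
  ring

lemma aux_inner (q s : ℝ) (hs : 0 < s) (hq2 : q ≠ 1 / 2) (hq3 : q ≠ 3 / 4) :
    ∫ r in (0 : ℝ)..s, r * (1 + r) ^ (1 - 4 * q) =
      (1 + s) ^ (3 - 4 * q) / (3 - 4 * q) - (1 + s) ^ (2 - 4 * q) / (2 - 4 * q)
        + 1 / ((2 - 4 * q) * (3 - 4 * q)) := by
  have ha : 3 - 4 * q ≠ 0 := fun h => hq3 (by linarith)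
  have hb : 2 - 4 * q ≠ 0 := fun h => hq2 (by linarith)
  have hd : ∀ r ∈ Set.uIcc 0 s, HasDerivAt
      (fun r : ℝ => (1 + r) ^ (3 - 4 * q) / (3 - 4 * q) - (1 + r) ^ (2 - 4 * q) / (2 - 4 * q))
      (r * (1 + r) ^ (1 - 4 * q)) r := by
    intro r hr
    rw [Set.uIcc_of_le hs.le] at hr
    have hr0 : 0 < 1 + r := by linarith [hr.1]
    have h0 : HasDerivAt (fun r : ℝ => 1 + r) 1 r := (hasDerivAt_id r).const_add 1
    have h1 := (h0.rpow_const (p := 3 - 4 * q) (Or.inl hr0.ne')).div_const (3 - 4 * q)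
    have h2 := (h0.rpow_const (p := 2 - 4 * q) (Or.inl hr0.ne')).div_const (2 - 4 * q)
    convert! h1.sub h2 using 1
    rw [show 3 - 4 * q - 1 = (1 - 4 * q) + 1 by ring, show 2 - 4 * q - 1 = 1 - 4 * q by ring,
      Real.rpow_add_one hr0.ne']
    field_simp
    ring
  rw [intervalIntegral.integral_eq_sub_of_hasDerivAt hd]
  · simp only [add_zero, Real.one_rpow]
    field_simp
    ring
  · apply ContinuousOn.intervalIntegrable
    intro r hr
    rw [Set.uIcc_of_le hs.le] at hr
    have hr0 : 0 < 1 + r := by linarith [hr.1]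
    apply ContinuousAt.continuousWithinAt
    exact continuousAt_id.mul
      ((continuousAt_const.add continuousAt_id).rpow_const (Or.inl hr0.ne'))

lemma aux_pow (p : ℝ) (hp : 0 < p) :
    IntegrableOn (fun s : ℝ => (1 + s) ^ (-p - 1)) (Set.Ioi 0) ∧
      ∫ s in Set.Ioi (0 : ℝ), (1 + s) ^ (-p - 1) = 1 / p := by
  constructor
  · have := integrableOn_add_rpow_Ioi_of_lt (a := -p - 1) (c := 0) (m := 1) (by linarith) (by norm_num)
    simpa [add_comm] using this
  · have h : ∫ s in Set.Ioi (0 : ℝ), (1 + s) ^ (-p - 1) =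
        ∫ s in Set.Ioi (0 + 1 : ℝ), s ^ (-p - 1) := by
      have h := (measurePreserving_add_left volume (1 : ℝ)).setIntegral_preimage_emb
        (measurableEmbedding_addLeft (1 : ℝ)) (fun t : ℝ => t ^ (-p - 1)) (Set.Ioi (0 + 1))
      rw [← h]
      simp
    rw [h, zero_add, integral_Ioi_rpow_of_lt (by linarith) (by norm_num)]
    simp [neg_div_neg_eq]

open Filter Topology in
lemma aux_cot (x : ℝ) (h0 : 0 < x) (h2 : x < 2) (h1 : x ≠ 1) :
    Tendsto (fun N : ℕ => ∑ n ∈ Finset.range N, (1 / (n + x) - 1 / (n + 3 - x))) atTop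
      (𝓝 (π * Real.cot (π * x) + 1 / (1 - x) + 1 / (2 - x))) := by
  have hx : (x : ℂ) ∈ Complex.integerComplement := by
    rw [Complex.mem_integerComplement_iff]
    rintro ⟨n, hn⟩
    have hn' : (n : ℝ) = x := by exact_mod_cast hn
    have a1 : 0 < n := by exact_mod_cast hn' ▸ h0
    have a2 : n < 2 := by exact_mod_cast hn' ▸ h2
    have : n = 1 := by omega
    subst this
    exact h1 (by simpa using hn'.symm)
  have hc := tendsto_logDeriv_euler_cot_sub hx
  have hr : Tendsto (fun N : ℕ => ∑ j ∈ Finset.range N, (1 / (x - (j + 1)) + 1 / (x + (j + 1))))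
      atTop (𝓝 (π * Real.cot (π * x) - 1 / x)) := by
    rw [← Filter.tendsto_ofReal_iff]
    convert! hc using 2
    · simp [cotTerm]
    · simp
  have hid : ∀ N : ℕ, ∑ n ∈ Finset.range N, (1 / (n + x) - 1 / (n + 3 - x)) =
      (∑ j ∈ Finset.range N, (1 / (x - (j + 1)) + 1 / (x + (j + 1)))) + 1 / x - 1 / ((N : ℝ) + x)
        + 1 / (1 - x) + 1 / (2 - x) - 1 / ((N : ℝ) + (1 - x)) - 1 / ((N : ℝ) + (2 - x)) := by
    intro N
    induction N with
    | zero => simp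
    | succ k ih =>
      rw [Finset.sum_range_succ, Finset.sum_range_succ, ih]
      push_cast
      have e1 : 1 / (x - ((k : ℝ) + 1)) = - (1 / ((k : ℝ) + (1 - x))) := by
        rw [← one_div_neg_eq_neg_one_div]; ring_nf
      rw [e1]
      ring_nf
  have ht : ∀ c : ℝ, Tendsto (fun N : ℕ => 1 / ((N : ℝ) + c)) atTop (𝓝 0) := by
    intro c
    simp only [one_div]
    exact tendsto_inv_atTop_zero.comp (tendsto_atTop_add_const_right _ c tendsto_natCast_atTop_atTop)
  simp_rw [hid]
  have := (((((hr.add_const (1 / x)).sub (ht x)).add_const (1 / (1 - x))).add_const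
    (1 / (2 - x))).sub (ht (1 - x))).sub (ht (2 - x))
  convert! this using 2
  ring

open Filter Topology in
lemma aux_tel (x : ℝ) :
    Tendsto (fun N : ℕ => ∑ n ∈ Finset.range N, (1 / (n + x) - 1 / (n + 1 + x))) atTop
      (𝓝 (1 / x)) := by
  have ht : Tendsto (fun N : ℕ => 1 / ((N : ℝ) + x)) atTop (𝓝 0) := by
    simp only [one_div]
    exact tendsto_inv_atTop_zero.comp (tendsto_atTop_add_const_right _ x tendsto_natCast_atTop_atTop)
  have : ∀ N : ℕ, ∑ n ∈ Finset.range N, (1 / ((n : ℝ) + x) - 1 / (n + 1 + x)) =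
      1 / x - 1 / ((N : ℝ) + x) := by
    intro N
    have := Finset.sum_range_sub' (fun n : ℕ => 1 / ((n : ℝ) + x)) N
    simpa using this
  simp_rw [this]
  simpa using ht.const_sub (1 / x)

/-- For `0 < q < 1`, `q ≠ 1/2`, `q ≠ 3/4`, the average ratio of right cookies to total cookies
eaten in a single right-left cycle:
`4q(1-q) ∫_0^∞ (1/s)(1+s)^{2q-3} (∫_0^s r(1+r)^{1-4q} dr) ds
  = 1 - 2q²/(1-2q)² - (2πq(1-q)/((1-2q)(3-4q))) cot(2πq)`. -/
theorem mean_ratio_right_to_total (q : ℝ) (hq0 : 0 < q) (hq1 : q < 1)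
    (hq2 : q ≠ 1 / 2) (hq3 : q ≠ 3 / 4) :
    IntegrableOn
      (fun s : ℝ => (1 / s) * (1 + s) ^ (2 * q - 3) * ∫ r in (0 : ℝ)..s, r * (1 + r) ^ (1 - 4 * q))
      (Set.Ioi 0) ∧
    4 * q * (1 - q) *
        ∫ s in Set.Ioi (0 : ℝ),
          (1 / s) * (1 + s) ^ (2 * q - 3) * ∫ r in (0 : ℝ)..s, r * (1 + r) ^ (1 - 4 * q) =
      1 - 2 * q ^ 2 / (1 - 2 * q) ^ 2 -
        (2 * Real.pi * q * (1 - q) / ((1 - 2 * q) * (3 - 4 * q))) * Real.cot (2 * Real.pi * q) := by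

  have ha : 3 - 4 * q ≠ 0 := fun h => hq3 (by linarith)
  have hb : 2 - 4 * q ≠ 0 := fun h => hq2 (by linarith)
  have hb' : 1 - 2 * q ≠ 0 := fun h => hq2 (by linarith)
  have hb'' : 1 - q ≠ 0 := by linarith
  set c : ℝ := 1 / ((2 - 4 * q) * (3 - 4 * q)) with hc
  set F : ℕ → ℝ → ℝ := fun n s =>
    (1 / (3 - 4 * q)) * (1 + s) ^ (-((n : ℝ) + 2 * q) - 1)
      - (1 / (2 - 4 * q)) * (1 + s) ^ (-((n : ℝ) + 1 + 2 * q) - 1)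
      + c * (1 + s) ^ (-((n : ℝ) + 3 - 2 * q) - 1) with hFdef
  have P : ∀ n : ℕ, (0 : ℝ) ≤ n := fun n => Nat.cast_nonneg n
  have p1 : ∀ n : ℕ, 0 < (n : ℝ) + 2 * q := fun n => by linarith [P n]
  have p2 : ∀ n : ℕ, 0 < (n : ℝ) + 1 + 2 * q := fun n => by linarith [P n]
  have p3 : ∀ n : ℕ, 0 < (n : ℝ) + 3 - 2 * q := fun n => by linarith [P n]
  have hFeq : ∀ n : ℕ, ∀ s : ℝ, 0 < s → F n s =
      ((1 + s) ^ (2 * q - 3) * ∫ r in (0 : ℝ)..s, r * (1 + r) ^ (1 - 4 * q)) * (1 + s)⁻¹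
        * ((1 + s)⁻¹) ^ n := by
    intro n s hs
    have hu : 0 < 1 + s := by linarith
    rw [aux_inner q s hs hq2 hq3, ← hc, ← Real.rpow_natCast, ← Real.rpow_neg_one (1 + s),
      ← Real.rpow_mul hu.le]
    simp only [hFdef]
    have e1 : (1 + s) ^ (-((n : ℝ) + 2 * q) - 1) =
        (1 + s) ^ (2 * q - 3) * (1 + s) ^ (3 - 4 * q) * (1 + s) ^ (-1 : ℝ) * (1 + s) ^ (-1 * (n : ℝ)) := by
      rw [← Real.rpow_add hu, ← Real.rpow_add hu, ← Real.rpow_add hu]; ring_nf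
    have e2 : (1 + s) ^ (-((n : ℝ) + 1 + 2 * q) - 1) =
        (1 + s) ^ (2 * q - 3) * (1 + s) ^ (2 - 4 * q) * (1 + s) ^ (-1 : ℝ) * (1 + s) ^ (-1 * (n : ℝ)) := by
      rw [← Real.rpow_add hu, ← Real.rpow_add hu, ← Real.rpow_add hu]; ring_nf
    have e3 : (1 + s) ^ (-((n : ℝ) + 3 - 2 * q) - 1) =
        (1 + s) ^ (2 * q - 3) * (1 + s) ^ (-1 : ℝ) * (1 + s) ^ (-1 * (n : ℝ)) := by
      rw [← Real.rpow_add hu, ← Real.rpow_add hu]; ring_nf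
    rw [e1, e2, e3]
    ring
  have hi : ∀ n, Integrable (F n) (volume.restrict (Set.Ioi 0)) := fun n => by
    exact (((aux_pow _ (p1 n)).1.const_mul _).sub ((aux_pow _ (p2 n)).1.const_mul _)).add
      ((aux_pow _ (p3 n)).1.const_mul _)
  have hI : ∀ n : ℕ, ∫ s in Set.Ioi (0 : ℝ), F n s =
      (1 / (2 - 4 * q)) * (1 / ((n : ℝ) + 2 * q) - 1 / (n + 1 + 2 * q))
        - c * (1 / ((n : ℝ) + 2 * q) - 1 / (n + 3 - 2 * q)) := by
    intro n
    simp only [hFdef]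
    have hsub : Integrable (fun s : ℝ => (1 / (3 - 4 * q)) * (1 + s) ^ (-((n : ℝ) + 2 * q) - 1)
      - (1 / (2 - 4 * q)) * (1 + s) ^ (-((n : ℝ) + 1 + 2 * q) - 1)) (volume.restrict (Set.Ioi 0)) :=
      ((aux_pow _ (p1 n)).1.const_mul _).sub ((aux_pow _ (p2 n)).1.const_mul _)
    rw [integral_add hsub ((aux_pow _ (p3 n)).1.const_mul _),
      integral_sub ((aux_pow _ (p1 n)).1.const_mul _) ((aux_pow _ (p2 n)).1.const_mul _),
      integral_const_mul, integral_const_mul, integral_const_mul, (aux_pow _ (p1 n)).2,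
      (aux_pow _ (p2 n)).2, (aux_pow _ (p3 n)).2]
    have : 1 / (3 - 4 * q) = 1 / (2 - 4 * q) - c := by rw [hc]; field_simp; ring
    rw [this]
    ring
  have hnn : ∀ n, 0 ≤ᵐ[volume.restrict (Set.Ioi 0)] F n := by
    intro n
    filter_upwards [ae_restrict_mem measurableSet_Ioi] with s hs
    have hs : 0 < s := hs
    have hu : 0 < 1 + s := by linarith
    have : 0 ≤ ∫ r in (0 : ℝ)..s, r * (1 + r) ^ (1 - 4 * q) :=
      intervalIntegral.integral_nonneg hs.le fun r hr =>
        mul_nonneg hr.1 (Real.rpow_nonneg (by linarith [hr.1]) _)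
    rw [hFeq n s hs]
    positivity
  have hL : HasSum (fun n => ∫ s in Set.Ioi (0 : ℝ), F n s)
      ((1 / (2 - 4 * q)) * (1 / (2 * q)) - c * (π * Real.cot (π * (2 * q)) + 1 / (1 - 2 * q)
        + 1 / (2 - 2 * q))) := by
    rw [hasSum_iff_tendsto_nat_of_nonneg (fun n => integral_nonneg_of_ae (hnn n))]
    simp_rw [hI, Finset.sum_sub_distrib (f := fun n : ℕ => 1 / (2 - 4 * q) * (1 / ((n : ℝ) + 2 * q) - 1 / (n + 1 + 2 * q))), ← Finset.mul_sum]
    exact ((aux_tel (2 * q)).const_mul _).sub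
      ((aux_cot (2 * q) (by linarith) (by linarith) (fun h => hq2 (by linarith))).const_mul c)
  obtain ⟨r1, r2⟩ := aux_sum F
    (fun s : ℝ => (1 / s) * (1 + s) ^ (2 * q - 3) * ∫ r in (0 : ℝ)..s, r * (1 + r) ^ (1 - 4 * q))
    _ hi hnn hL (by
      filter_upwards [ae_restrict_mem measurableSet_Ioi] with s hs
      have hs : 0 < s := hs
      have hu : 0 < 1 + s := by linarith
      simp_rw [hFeq _ s hs]
      have hg := (hasSum_geometric_of_lt_one (r := (1 + s)⁻¹) (by positivity)
        (inv_lt_one_of_one_lt₀ (by linarith))).mul_left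
          (((1 + s) ^ (2 * q - 3) * ∫ r in (0 : ℝ)..s, r * (1 + r) ^ (1 - 4 * q)) * (1 + s)⁻¹)
      convert! hg using 1
      have : (1 + s)⁻¹ * (1 - (1 + s)⁻¹)⁻¹ = 1 / s := by
        have : 1 - (1 + s)⁻¹ = s / (1 + s) := by field_simp; ring
        rw [this]; field_simp
      rw [mul_assoc _ (1 + s)⁻¹, this]
      ring)
  refine ⟨r1, ?_⟩
  rw [r2, hc, show π * (2 * q) = 2 * π * q by ring]
  have hb4 : 2 - 4 * q = 2 * (1 - 2 * q) := by ring
  have hb5 : 2 - 2 * q = 2 * (1 - q) := by ring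
  rw [hb4, hb5]
  exact aux_alg q _ _ _ π _ rfl rfl rfl hq0.ne' hb' ha hb''
end

section
/- Let L ≥ 2 be an integer and let T : {2, 3, …, L+1} → ℝ satisfy T(L+1) = 3(L-1) and, for every integer k with 2 ≤ k ≤ L, T(k) = (2/k)·((k²-4)/3) + (1 - 2/k)·((4k-4)/3 + 1 + T(k+1)). Then for every integer k with 2 ≤ k ≤ L+1, T(k) = 3(k-2) + 2(k-1)(k-2) ∑_{j=k}^{L} 1/j (the sum being empty when k = L+1). -/
/-- Closed form for the lower bound on the mean escape time of a 2-excited walk from a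
cookie-free defect: if `T(L+1) = 3(L-1)` and for `2 ≤ k ≤ L`
`T(k) = (2/k)((k²-4)/3) + (1-2/k)((4k-4)/3 + 1 + T(k+1))`, then for all `2 ≤ k ≤ L+1`
`T(k) = 3(k-2) + 2(k-1)(k-2) ∑_{j=k}^L 1/j`. -/
theorem defect_escape_time_closed_form (L : ℕ) (hL : 2 ≤ L) (T : ℕ → ℝ)
    (hTtop : T (L + 1) = 3 * ((L : ℝ) - 1))
    (hrec : ∀ k : ℕ, 2 ≤ k → k ≤ L →
      T k = (2 / (k : ℝ)) * (((k : ℝ) ^ 2 - 4) / 3) +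
        (1 - 2 / (k : ℝ)) * ((4 * (k : ℝ) - 4) / 3 + 1 + T (k + 1))) :
    ∀ k : ℕ, 2 ≤ k → k ≤ L + 1 →
      T k = 3 * ((k : ℝ) - 2) +
        2 * ((k : ℝ) - 1) * ((k : ℝ) - 2) * ∑ j ∈ Finset.Icc k L, (1 / (j : ℝ)) := by
  intro k hk hkL
  induction hkL using Nat.decreasingInduction with
  | self =>
    rw [hTtop, Finset.Icc_eq_empty (by omega)]
    push_cast
    simp
    ring
  | of_succ k hlt ih =>
    have hkL : k ≤ L := by omega
    have ih' := ih (by omega)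
    have hk0 : (k : ℝ) ≠ 0 := by
      have : k ≠ 0 := by omega
      exact_mod_cast this
    have hs : ∑ j ∈ Finset.Icc k L, (1 / (j : ℝ))
        = 1 / (k : ℝ) + ∑ j ∈ Finset.Icc (k + 1) L, (1 / (j : ℝ)) := by
      rw [← Finset.insert_Icc_add_one_left_eq_Icc hkL, Finset.sum_insert (by simp)]
    rw [hrec k hk hkL, ih', hs]
    generalize ∑ j ∈ Finset.Icc (k + 1) L, (1 / (j : ℝ)) = S
    push_cast
    field_simp
    ring
end
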